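/- arXiv:1605.01036 — 4 statements merged into one kernel-verified Lean document; each statement's English description precedes it below -/
import Mathlib

section
/- Every local minimum of the OMM functional E₀ is a global minimum: if X₀ ∈ ℂ^{N×m} is a local minimizer of E₀ with respect to the Frobenius norm, then E₀(X₀) ≤ E₀(Y) for all Y ∈ ℂ^{N×m}. -/
open Matrix
open scoped ComplexOrder

attribute [local instance] Matrix.frobeniusSeminormedAddCommGroup
  Matrix.frobeniusNormedAddCommGroup Matrix.frobeniusNormedSpace

/-- The OMM functional `E₀(X) = tr[(2I − X*X) X*HX]` (real-valued, since `H` is Hermitian). -/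
noncomputable def E0 {N m : ℕ} (H : Matrix (Fin N) (Fin N) ℂ)
    (X : Matrix (Fin N) (Fin m) ℂ) : ℝ :=
  (((2 : ℂ) • (1 : Matrix (Fin m) (Fin m) ℂ) - Xᴴ * X) * (Xᴴ * H * X)).trace.re

section helpers
variable {N m : ℕ}

lemma poly_aux (c1 c2 c3 c4 δ : ℝ) (hδ : 0 < δ)
    (h : ∀ t : ℝ, |t| < δ → 0 ≤ t * c1 + t^2 * c2 + t^3 * c3 + t^4 * c4) :
    c1 = 0 ∧ 0 ≤ c2 := by
  have key1 : ∀ s : ℝ, s = 1 ∨ s = -1 → 0 ≤ s * c1 := by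
    intro s hs
    have hcont : Filter.Tendsto (fun t : ℝ => s * c1 + t * c2 + s * t^2 * c3 + t^3 * c4)
        (nhdsWithin 0 (Set.Ioi 0)) (nhds (s * c1)) := by
      have : Continuous (fun t : ℝ => s * c1 + t * c2 + s * t^2 * c3 + t^3 * c4) := by fun_prop
      have h2 := this.tendsto 0
      simp only [zero_mul, add_zero, ne_eq, OfNat.ofNat_ne_zero, not_false_eq_true, zero_pow,
        mul_zero] at h2
      exact h2.mono_left nhdsWithin_le_nhds
    refine ge_of_tendsto hcont ?_
    filter_upwards [Ioo_mem_nhdsGT hδ] with t ht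
    have hs2 : s^2 = 1 := by rcases hs with rfl | rfl <;> norm_num
    have hs1 : |s| = 1 := by rcases hs with rfl | rfl <;> norm_num
    have := h (s * t) (by rw [abs_mul, hs1, one_mul, abs_of_pos ht.1]; exact ht.2)
    have e : s * t * c1 + (s*t)^2 * c2 + (s*t)^3 * c3 + (s*t)^4 * c4 =
      t * (s * c1 + t * c2 + s * t^2 * c3 + t^3 * c4) := by
      have h3 : s^3 = s := by rw [pow_succ, hs2, one_mul]
      have h4 : s^4 = 1 := by rw [pow_succ, h3, ← sq, hs2]
      rw [mul_pow, mul_pow, mul_pow, hs2, h3, h4]; ring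
    rw [e] at this
    exact nonneg_of_mul_nonneg_right this ht.1
  have hc : c1 = 0 := by
    have a := key1 1 (Or.inl rfl)
    have b := key1 (-1) (Or.inr rfl)
    linarith
  refine ⟨hc, ?_⟩
  have hcont : Filter.Tendsto (fun t : ℝ => c2 + t * c3 + t^2 * c4)
      (nhdsWithin 0 (Set.Ioi 0)) (nhds c2) := by
    have : Continuous (fun t : ℝ => c2 + t * c3 + t^2 * c4) := by fun_prop
    have h2 := this.tendsto 0
    simp only [zero_mul, add_zero, ne_eq, OfNat.ofNat_ne_zero, not_false_eq_true, zero_pow] at h2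
    exact h2.mono_left nhdsWithin_le_nhds
  refine ge_of_tendsto hcont ?_
  filter_upwards [Ioo_mem_nhdsGT hδ] with t ht
  have := h t (by rw [abs_of_pos ht.1]; exact ht.2)
  have e : t * c1 + t^2 * c2 + t^3 * c3 + t^4 * c4 = t^2 * (c2 + t * c3 + t^2 * c4) := by
    rw [hc]; ring
  rw [e] at this
  exact nonneg_of_mul_nonneg_right this (pow_pos ht.1 2)

/-- E0 in terms of `A = -H` and `P = X Xᴴ`. -/
lemma E0_eq (H : Matrix (Fin N) (Fin N) ℂ) (X : Matrix (Fin N) (Fin m) ℂ) :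
    E0 H X = ((-H) * ((X * Xᴴ) * (X * Xᴴ))).trace.re - 2 * ((-H) * (X * Xᴴ)).trace.re := by
  unfold E0
  have h1 : (Xᴴ * H * X).trace = (H * (X * Xᴴ)).trace := by
    rw [Matrix.mul_assoc, Matrix.trace_mul_comm, Matrix.mul_assoc]
  have h2 : (Xᴴ * X * (Xᴴ * H * X)).trace = (H * ((X * Xᴴ) * (X * Xᴴ))).trace := by
    rw [Matrix.trace_mul_comm, Matrix.mul_assoc, Matrix.mul_assoc, Matrix.trace_mul_comm]
    simp only [Matrix.mul_assoc]
  rw [Matrix.sub_mul, Matrix.trace_sub, Matrix.smul_mul, Matrix.one_mul, Matrix.trace_smul, h1, h2,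
    Matrix.neg_mul, Matrix.neg_mul, Matrix.trace_neg, Matrix.trace_neg]
  simp
  ring

lemma E0_expand (H : Matrix (Fin N) (Fin N) ℂ) (X D : Matrix (Fin N) (Fin m) ℂ) (t : ℝ)
    (P K W : Matrix (Fin N) (Fin N) ℂ)
    (hP : P = X * Xᴴ) (hK : K = X * Dᴴ + D * Xᴴ) (hW : W = D * Dᴴ) :
    E0 H (X + (t : ℂ) • D) = E0 H X
      + t * (((-H) * (P * K + K * P)).trace.re - 2 * ((-H) * K).trace.re)
      + t^2 * (((-H) * (K * K + P * W + W * P)).trace.re - 2 * ((-H) * W).trace.re)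
      + t^3 * ((-H) * (K * W + W * K)).trace.re
      + t^4 * ((-H) * (W * W)).trace.re := by
  have e : (X + (t : ℂ) • D) * (X + (t : ℂ) • D)ᴴ = P + (t : ℂ) • K + ((t^2 : ℝ) : ℂ) • W := by
    rw [hP, hK, hW]
    simp only [conjTranspose_add, conjTranspose_smul, Matrix.mul_add, Matrix.add_mul,
      Matrix.smul_mul, Matrix.mul_smul, smul_smul, smul_add, Complex.star_def, Complex.conj_ofReal,
      Complex.ofReal_mul, sq]
    abel
  rw [E0_eq, E0_eq, e, ← hP]
  simp only [Matrix.mul_add, Matrix.add_mul, Matrix.smul_mul, Matrix.mul_smul, Matrix.trace_add,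
    Matrix.trace_smul, smul_eq_mul, Complex.add_re, Complex.re_ofReal_mul]
  ring

lemma local_cond (H : Matrix (Fin N) (Fin N) ℂ) (X : Matrix (Fin N) (Fin m) ℂ)
    (hloc : ∃ ε > (0 : ℝ), ∀ Y : Matrix (Fin N) (Fin m) ℂ,
      ‖Y - X‖ < ε → E0 H X ≤ E0 H Y) (D : Matrix (Fin N) (Fin m) ℂ)
    (P K W : Matrix (Fin N) (Fin N) ℂ)
    (hP : P = X * Xᴴ) (hK : K = X * Dᴴ + D * Xᴴ) (hW : W = D * Dᴴ) :
    ((-H) * (P * K + K * P)).trace.re - 2 * ((-H) * K).trace.re = 0 ∧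
    0 ≤ ((-H) * (K * K + P * W + W * P)).trace.re - 2 * ((-H) * W).trace.re := by
  obtain ⟨ε, hε, h⟩ := hloc
  refine poly_aux _ _ ((-H) * (K * W + W * K)).trace.re ((-H) * (W * W)).trace.re
    (ε / (‖D‖ + 1)) (by positivity) ?_
  intro t ht
  have h1 := h (X + (t : ℂ) • D) (by
    rw [add_sub_cancel_left, norm_smul, Complex.norm_real, Real.norm_eq_abs]
    rw [lt_div_iff₀ (by positivity)] at ht
    nlinarith [abs_nonneg t, norm_nonneg D])
  rw [E0_expand H X D t P K W hP hK hW] at h1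
  linarith

lemma re_trace_conj (M : Matrix (Fin N) (Fin N) ℂ) : (Mᴴ).trace.re = M.trace.re := by
  rw [Matrix.trace_conjTranspose]; simp

lemma quad_nonneg {k : ℕ} {A : Matrix (Fin N) (Fin N) ℂ} (hA : A.PosDef)
    (L : Matrix (Fin N) (Fin k) ℂ) : 0 ≤ (Lᴴ * A * L).trace.re := by
  have := (hA.posSemidef.conjTranspose_mul_mul_same L).trace_nonneg
  exact (Complex.le_def.1 this).1

lemma quad_zero {k : ℕ} {A : Matrix (Fin N) (Fin N) ℂ} (hA : A.PosDef)
    (L : Matrix (Fin N) (Fin k) ℂ) (h : (Lᴴ * A * L).trace.re ≤ 0) : L = 0 := by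
  have hp := hA.posSemidef.conjTranspose_mul_mul_same L
  have hn := hp.trace_nonneg
  have h0 : (Lᴴ * A * L).trace = 0 := by
    have := Complex.le_def.1 hn
    apply Complex.ext
    · exact le_antisymm h this.1
    · exact this.2.symm
  have h1 : Lᴴ * A * L = 0 := hp.trace_eq_zero_iff.1 h0
  ext i j
  by_contra hne
  have hx : (fun i => L i j) ≠ 0 := fun hh => hne (congrFun hh i)
  have h2 := hA.dotProduct_mulVec_pos hx
  have h3 : star (fun i => L i j) ⬝ᵥ (A *ᵥ (fun i => L i j)) = (Lᴴ * A * L) j j := by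
    rw [Matrix.mul_assoc]
    rfl
  rw [h3, h1] at h2
  simp at h2

/-- A Hermitian projection `T` of trace at most `m` fixing the columns of `Y`. -/
lemma exists_proj (Y : Matrix (Fin N) (Fin m) ℂ) : ∃ T : Matrix (Fin N) (Fin N) ℂ,
    Tᴴ = T ∧ T * T = T ∧ T * Y = Y ∧ T.trace.re ≤ m := by
  have hS : (Yᴴ * Y).IsHermitian := Matrix.isHermitian_conjTranspose_mul_self Y
  obtain ⟨G, hG, hSGS, hGSG, htr⟩ : ∃ G : Matrix (Fin m) (Fin m) ℂ, Gᴴ = G ∧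
      (Yᴴ * Y) * G * (Yᴴ * Y) = Yᴴ * Y ∧ G * (Yᴴ * Y) * G = G ∧ (G * (Yᴴ * Y)).trace.re ≤ m := by
    set U : Matrix (Fin m) (Fin m) ℂ := (hS.eigenvectorUnitary : Matrix (Fin m) (Fin m) ℂ) with hU
    set d := hS.eigenvalues with hd
    have hUU : Uᴴ * U = 1 := by
      have := Unitary.coe_star_mul_self hS.eigenvectorUnitary
      exact this
    have hspec : Yᴴ * Y = U * diagonal (fun i => (d i : ℂ)) * Uᴴ := by
      have := hS.spectral_theorem
      rw [Unitary.conjStarAlgAut_apply] at this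
      exact this
    have hmul : ∀ a b : Fin m → ℂ, (U * diagonal a * Uᴴ) * (U * diagonal b * Uᴴ) =
        U * diagonal (fun i => a i * b i) * Uᴴ := by
      intro a b
      calc _ = U * diagonal a * (Uᴴ * U) * diagonal b * Uᴴ := by simp only [Matrix.mul_assoc]
        _ = _ := by rw [hUU, Matrix.mul_one, Matrix.mul_assoc U, diagonal_mul_diagonal]
    refine ⟨U * diagonal (fun i => ((d i : ℂ))⁻¹) * Uᴴ, ?_, ?_, ?_, ?_⟩
    · simp only [conjTranspose_mul, conjTranspose_conjTranspose, diagonal_conjTranspose,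
        Matrix.mul_assoc]
      congr 3
      ext i
      simp
    · rw [hspec, hmul, hmul]
      congr 3; ext i; exact mul_inv_mul_cancel _
    · rw [hspec, hmul, hmul]
      congr 3; ext i; by_cases h : (d i : ℂ) = 0 <;> simp [h]
    · rw [hspec, hmul, Matrix.trace_mul_comm, ← Matrix.mul_assoc, hUU, Matrix.one_mul,
        Matrix.trace_diagonal, Complex.re_sum]
      calc _ ≤ ∑ i : Fin m, (1 : ℝ) := by
            apply Finset.sum_le_sum
            intro i _
            by_cases h : d i = 0
            · simp [h]
            · have : (d i : ℂ) ≠ 0 := by exact_mod_cast h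
              rw [inv_mul_cancel₀ this]; simp
        _ = m := by simp
  refine ⟨Y * G * Yᴴ, ?_, ?_, ?_, ?_⟩
  · simp only [conjTranspose_mul, conjTranspose_conjTranspose, hG, Matrix.mul_assoc]
  · calc _ = Y * (G * (Yᴴ * Y) * G) * Yᴴ := by simp only [Matrix.mul_assoc]
      _ = _ := by rw [hGSG]
  · have hz : (Y * G * Yᴴ * Y - Y)ᴴ * (Y * G * Yᴴ * Y - Y) = 0 := by
      have e : (Y * G * Yᴴ * Y - Y)ᴴ * (Y * G * Yᴴ * Y - Y) =
        (Yᴴ * Y * G - 1) * ((Yᴴ * Y) * G * (Yᴴ * Y) - Yᴴ * Y) := by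
        simp only [conjTranspose_sub, conjTranspose_mul, conjTranspose_conjTranspose, hG,
          Matrix.mul_sub, Matrix.sub_mul, Matrix.mul_assoc, Matrix.one_mul]
      rw [e, hSGS, sub_self, Matrix.mul_zero]
    exact sub_eq_zero.1 (Matrix.conjTranspose_mul_self_eq_zero.1 hz)
  · rw [Matrix.mul_assoc, Matrix.trace_mul_comm, Matrix.mul_assoc]
    exact htr

lemma E0_lower (H : Matrix (Fin N) (Fin N) ℂ) (hA : (-H).PosDef) (Y : Matrix (Fin N) (Fin m) ℂ)
    (T : Matrix (Fin N) (Fin N) ℂ) (hT : Tᴴ = T) (hTT : T * T = T) (hTY : T * Y = Y) :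
    -((-H) * T).trace.re ≤ E0 H Y := by
  have hYT : Yᴴ * T = Yᴴ := by
    have := congrArg conjTranspose hTY
    rwa [conjTranspose_mul, hT] at this
  have h := quad_nonneg hA (Y * Yᴴ - T)
  have e : ((Y * Yᴴ - T)ᴴ * (-H) * (Y * Yᴴ - T)).trace =
      ((-H) * ((Y * Yᴴ) * (Y * Yᴴ))).trace - 2 * ((-H) * (Y * Yᴴ)).trace + ((-H) * T).trace := by
    rw [Matrix.mul_assoc, Matrix.trace_mul_comm, Matrix.mul_assoc]
    have : (Y * Yᴴ - T) * (Y * Yᴴ - T)ᴴ = (Y * Yᴴ) * (Y * Yᴴ) - Y * Yᴴ - Y * Yᴴ + T := by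
      rw [conjTranspose_sub, hT, conjTranspose_mul, conjTranspose_conjTranspose, Matrix.sub_mul,
        Matrix.mul_sub, Matrix.mul_sub, hTT, Matrix.mul_assoc Y Yᴴ T, hYT, ← Matrix.mul_assoc T, hTY]
      abel
    rw [this]
    simp only [Matrix.mul_add, Matrix.mul_sub, Matrix.trace_add, Matrix.trace_sub]
    ring
  rw [e] at h
  rw [E0_eq]
  simp only [Complex.add_re, Complex.sub_re, Complex.mul_re, Complex.re_ofNat, Complex.im_ofNat,
    zero_mul, sub_zero] at h
  linarith

/-- First-order condition. -/
lemma first_order (H : Matrix (Fin N) (Fin N) ℂ) (hH : Hᴴ = H) (X : Matrix (Fin N) (Fin m) ℂ)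
    (hloc : ∃ ε > (0 : ℝ), ∀ Y : Matrix (Fin N) (Fin m) ℂ,
      ‖Y - X‖ < ε → E0 H X ≤ E0 H Y) :
    X * Xᴴ * (-H) * X + (-H) * (X * Xᴴ) * X - (2 : ℂ) • ((-H) * X) = 0 := by
  set G := X * Xᴴ * (-H) * X + (-H) * (X * Xᴴ) * X - (2 : ℂ) • ((-H) * X) with hG
  have h := (local_cond H X hloc G _ _ _ rfl rfl rfl).1
  set A := -H with hAdef
  have hA : Aᴴ = A := by rw [hAdef, conjTranspose_neg, hH]
  set P := X * Xᴴ with hPdef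
  have hP : Pᴴ = P := by rw [hPdef, conjTranspose_mul, conjTranspose_conjTranspose]
  have r1 : (A * (P * (X * Gᴴ + G * Xᴴ) + (X * Gᴴ + G * Xᴴ) * P)).trace.re
      - 2 * (A * (X * Gᴴ + G * Xᴴ)).trace.re = 2 * (G * Gᴴ).trace.re := by
    have a1 : (A * (P * (G * Xᴴ))).trace.re = (A * ((X * Gᴴ) * P)).trace.re := by
      rw [← re_trace_conj]
      simp only [conjTranspose_mul, conjTranspose_conjTranspose, hA, hP]
      rw [Matrix.trace_mul_comm]
    have a2 : (A * ((G * Xᴴ) * P)).trace.re = (A * (P * (X * Gᴴ))).trace.re := by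
      rw [← re_trace_conj]
      simp only [conjTranspose_mul, conjTranspose_conjTranspose, hA, hP]
      rw [Matrix.trace_mul_comm]
    have a3 : (A * (G * Xᴴ)).trace.re = (A * (X * Gᴴ)).trace.re := by
      rw [← re_trace_conj]
      simp only [conjTranspose_mul, conjTranspose_conjTranspose, hA]
      rw [Matrix.trace_mul_comm]
    have a4 : (A * ((X * Gᴴ) * P)).trace = (P * A * X * Gᴴ).trace := by
      rw [← Matrix.mul_assoc, Matrix.trace_mul_comm]
      simp only [Matrix.mul_assoc]
    have a5 : (A * (P * (X * Gᴴ))).trace = (A * P * X * Gᴴ).trace := by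
      simp only [Matrix.mul_assoc]
    have a6 : (A * (X * Gᴴ)).trace = (A * X * Gᴴ).trace := by
      simp only [Matrix.mul_assoc]
    have a7 : (G * Gᴴ).trace.re = (P * A * X * Gᴴ).trace.re + (A * P * X * Gᴴ).trace.re
        - 2 * (A * X * Gᴴ).trace.re := by
      conv_lhs => arg 1; arg 1; arg 1; rw [hG]
      simp [Matrix.add_mul, Matrix.sub_mul]
    simp only [Matrix.mul_add, Matrix.add_mul, Matrix.trace_add, Complex.add_re]
    rw [a1, a2, a3, a4, a5, a6, a7]
    ring
  rw [r1] at h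
  have h2 : (Gᴴᴴ * (1 : Matrix (Fin m) (Fin m) ℂ) * Gᴴ).trace.re ≤ 0 := by
    rw [conjTranspose_conjTranspose, Matrix.mul_one]; linarith
  have := quad_zero (Matrix.PosDef.one) Gᴴ h2
  simpa using congrArg conjTranspose this

end helpers

/-- Every local minimum (w.r.t. the Frobenius norm) of the OMM functional `E₀` is a
global minimum. -/
theorem stmt0 {N m : ℕ} (hN : 0 < N) (hm : 0 < m) (hmN : m ≤ N)
    (H : Matrix (Fin N) (Fin N) ℂ) (hH : H.IsHermitian) (hneg : (-H).PosDef)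
    (X₀ : Matrix (Fin N) (Fin m) ℂ)
    (hloc : ∃ ε > (0 : ℝ), ∀ Y : Matrix (Fin N) (Fin m) ℂ,
      ‖Y - X₀‖ < ε → E0 H X₀ ≤ E0 H Y) :
    ∀ Y : Matrix (Fin N) (Fin m) ℂ, E0 H X₀ ≤ E0 H Y := by
  intro Y
  set X := X₀ with hX
  have hfo := first_order H hH X hloc
  have hso := fun D => (local_cond H X hloc D _ _ _ rfl rfl rfl).2
  have hE := E0_eq H X
  obtain ⟨T, hT, hTT, hTY, hTm⟩ := exists_proj Y
  have hlow := E0_lower H hneg Y T hT hTT hTY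
  have hAH : (-H)ᴴ = -H := by rw [conjTranspose_neg, hH]
  generalize -H = A at *
  -- X F = 0
  have hXF : X * (Xᴴ * X - 1) = 0 := by
    set F := Xᴴ * X - 1 with hF
    have hFF : Fᴴ = F := by simp [hF]
    have hB : F * (Xᴴ * A * X) + (Xᴴ * A * X) * F = 0 := by
      have := congrArg (fun Z => Xᴴ * Z) hfo
      simp only [Matrix.mul_zero] at this
      rw [← this, hF]
      simp only [Matrix.mul_add, Matrix.mul_sub, Matrix.sub_mul, Matrix.mul_assoc, Matrix.one_mul,
        Matrix.mul_one, two_smul]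
      abel
    apply quad_zero hneg
    have e : ((X * F)ᴴ * A * (X * F)).trace = (F * (Xᴴ * A * X) * F).trace := by
      rw [conjTranspose_mul, hFF]; simp only [Matrix.mul_assoc]
    have e2 : (F * (Xᴴ * A * X) * F).trace = -(F * (Xᴴ * A * X) * F).trace := by
      conv_lhs => rw [eq_neg_of_add_eq_zero_left hB]
      rw [Matrix.neg_mul, Matrix.trace_neg, Matrix.trace_mul_comm, ← Matrix.mul_assoc]
    rw [e]
    have e3 := congrArg Complex.re e2
    rw [Complex.neg_re] at e3
    linarith
  have hXS : X * (Xᴴ * X) = X := by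
    rw [Matrix.mul_sub, Matrix.mul_one] at hXF
    exact sub_eq_zero.1 hXF
  have hPH : (X * Xᴴ)ᴴ = X * Xᴴ := by rw [conjTranspose_mul, conjTranspose_conjTranspose]
  have hPX : X * Xᴴ * X = X := by rw [Matrix.mul_assoc, hXS]
  have hXP : Xᴴ * (X * Xᴴ) = Xᴴ := by
    have := congrArg conjTranspose hPX
    rwa [conjTranspose_mul, hPH] at this
  have hPP : X * Xᴴ * (X * Xᴴ) = X * Xᴴ := by rw [← Matrix.mul_assoc, hPX]
  have hPAX : X * Xᴴ * A * X = A * X := by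
    rw [Matrix.mul_assoc A, hPX, two_smul] at hfo
    have : X * Xᴴ * A * X + A * X - (A * X + A * X) = X * Xᴴ * A * X - A * X := by abel
    rw [this] at hfo
    exact sub_eq_zero.1 hfo
  have hcomm : X * Xᴴ * A = A * (X * Xᴴ) := by
    have h1 : X * Xᴴ * A * (X * Xᴴ) = A * (X * Xᴴ) := by
      rw [← Matrix.mul_assoc, hPAX, Matrix.mul_assoc]
    have h2 := congrArg conjTranspose h1
    simp only [conjTranspose_mul, conjTranspose_conjTranspose, hAH] at h2
    rw [← h2, ← Matrix.mul_assoc, h1]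
  -- second-order condition for D with Xᴴ D = 0
  have hS1 : Xᴴ * X = 1 := by
    obtain ⟨F, hF⟩ : ∃ F, F = Xᴴ * X - 1 := ⟨_, rfl⟩
    rw [← hF] at hXF
    have hFF : Fᴴ = F := by simp [hF]
    by_cases hP1 : X * Xᴴ = 1
    · have hF2 : F * F = -F := by
        have : F * F = Xᴴ * (X * F) - F := by
          conv_lhs => arg 1; rw [hF]
          rw [Matrix.sub_mul, Matrix.one_mul, Matrix.mul_assoc]
        rw [this, hXF]; simp
      have htr : F.trace = (N : ℂ) - m := by
        rw [hF, Matrix.trace_sub, Matrix.trace_mul_comm, hP1]; simp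
      have : F = 0 := by
        apply quad_zero Matrix.PosDef.one
        rw [Matrix.mul_one, hFF, hF2, Matrix.trace_neg, htr]
        have : (m : ℝ) ≤ N := by exact_mod_cast hmN
        simpa using this
      exact sub_eq_zero.1 (hF.symm.trans this)
    · have hz : ∀ Z : Matrix (Fin N) (Fin m) ℂ, (1 - X * Xᴴ) * Z * F = 0 := by
        intro Z
        obtain ⟨D, hD⟩ : ∃ D, D = (1 - X * Xᴴ) * Z * F := ⟨_, rfl⟩
        rw [← hD]
        have k2 : X * Dᴴ = 0 := by
          rw [hD, conjTranspose_mul, hFF, ← Matrix.mul_assoc, hXF, Matrix.zero_mul]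
        have k3 : D * Xᴴ = 0 := by
          have := congrArg conjTranspose k2
          simpa using this
        have k4 : Xᴴ * D = 0 := by
          rw [hD, ← Matrix.mul_assoc, ← Matrix.mul_assoc, Matrix.mul_sub, hXP]; simp
        have k5 : Dᴴ * X = 0 := by
          have := congrArg conjTranspose k4
          simpa using this
        have h := hso D
        have k6 : X * Xᴴ * (D * Dᴴ) = 0 := by
          rw [Matrix.mul_assoc, ← Matrix.mul_assoc Xᴴ, k4]; simp
        have k7 : D * Dᴴ * (X * Xᴴ) = 0 := by
          rw [Matrix.mul_assoc, ← Matrix.mul_assoc Dᴴ, k5]; simp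
        rw [k2, k3, k6, k7] at h
        simp only [add_zero, Matrix.mul_zero, Matrix.trace_zero, Complex.zero_re] at h
        apply quad_zero hneg
        rw [Matrix.mul_assoc, Matrix.trace_mul_comm, Matrix.mul_assoc]
        linarith
      have hQ : (1 - X * Xᴴ) ≠ 0 := fun h => hP1 (sub_eq_zero.1 h).symm
      obtain ⟨a, i, hai⟩ : ∃ a i, (1 - X * Xᴴ : Matrix (Fin N) (Fin N) ℂ) a i ≠ 0 := by
        by_contra hcon
        push Not at hcon
        exact hQ (by ext a i; exact hcon a i)
      have : F = 0 := by
        ext j b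
        have h1 := congrFun (congrFun (hz (Matrix.single i j 1)) a) b
        rw [Matrix.mul_assoc, Matrix.mul_apply, Finset.sum_eq_single i] at h1
        · simp only [Matrix.single_mul_apply_same, one_mul, Matrix.zero_apply] at h1
          exact (mul_eq_zero.1 h1).resolve_left hai
        · intro c _ hc
          rw [Matrix.single_mul_apply_of_ne _ _ _ _ _ hc]; simp
        · simp
      exact sub_eq_zero.1 (hF.symm.trans this)
  have hso2 : ∀ D : Matrix (Fin N) (Fin m) ℂ, Xᴴ * D = 0 →
      (Dᴴ * A * D).trace.re ≤ (D * (Xᴴ * A * X) * Dᴴ).trace.re := by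
    intro D k4
    have k5 : Dᴴ * X = 0 := by
      have := congrArg conjTranspose k4
      simpa using this
    have h := hso D
    have k6 : X * Xᴴ * (D * Dᴴ) = 0 := by
      rw [Matrix.mul_assoc, ← Matrix.mul_assoc Xᴴ, k4]; simp
    have k7 : D * Dᴴ * (X * Xᴴ) = 0 := by
      rw [Matrix.mul_assoc, ← Matrix.mul_assoc Dᴴ, k5]; simp
    have k8 : (X * Dᴴ + D * Xᴴ) * (X * Dᴴ + D * Xᴴ) = X * (Dᴴ * D) * Xᴴ + D * Dᴴ := by
      have q1 : X * Dᴴ * (X * Dᴴ) = 0 := by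
        rw [Matrix.mul_assoc, ← Matrix.mul_assoc Dᴴ, k5]; simp
      have q2 : D * Xᴴ * (D * Xᴴ) = 0 := by
        rw [Matrix.mul_assoc, ← Matrix.mul_assoc Xᴴ, k4]; simp
      have q3 : D * Xᴴ * (X * Dᴴ) = D * Dᴴ := by
        rw [Matrix.mul_assoc, ← Matrix.mul_assoc Xᴴ, hS1, Matrix.one_mul]
      rw [Matrix.add_mul, Matrix.mul_add, Matrix.mul_add, q1, q2, q3]
      simp only [Matrix.mul_assoc, zero_add, add_zero]
    rw [k6, k7, k8] at h
    simp only [add_zero, Matrix.mul_add, Matrix.trace_add, Complex.add_re] at h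
    have t1 : (A * (X * (Dᴴ * D) * Xᴴ)).trace = (D * (Xᴴ * A * X) * Dᴴ).trace := by
      calc _ = ((A * X * Dᴴ) * (D * Xᴴ)).trace := by simp only [Matrix.mul_assoc]
        _ = ((D * Xᴴ) * (A * X * Dᴴ)).trace := Matrix.trace_mul_comm _ _
        _ = _ := by simp only [Matrix.mul_assoc]
    have t2 : (Dᴴ * A * D).trace = (A * (D * Dᴴ)).trace := by
      rw [Matrix.mul_assoc, Matrix.trace_mul_comm, Matrix.mul_assoc]
    rw [t1] at h
    rw [t2]
    linarith
  -- bilinear form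
  obtain ⟨L, hL⟩ : ∃ L, L = (1 - X * Xᴴ) * T := ⟨_, rfl⟩
  obtain ⟨R, hR⟩ : ∃ R, R = (1 - T) * X := ⟨_, rfl⟩
  have hXL : Xᴴ * L = 0 := by
    rw [hL, ← Matrix.mul_assoc, Matrix.mul_sub, hXP]; simp
  have hRB : ((Xᴴ * A * X)).PosSemidef := hneg.posSemidef.conjTranspose_mul_mul_same X
  have hab : (Lᴴ * A * L).trace.re * (R * Rᴴ).trace.re ≤
      (Lᴴ * L).trace.re * (R * (Xᴴ * A * X) * Rᴴ).trace.re := by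
    have p1 : (Lᴴ * A * L).PosSemidef := hneg.posSemidef.conjTranspose_mul_mul_same L
    have p2 : (Lᴴ * L).PosSemidef := Matrix.posSemidef_conjTranspose_mul_self L
    have im1 : ∀ j, ((Lᴴ * A * L) j j).im = 0 := fun j =>
      ((Complex.le_def.1 (p1.diag_nonneg (i := j))).2).symm
    have im2 : ∀ j, ((Lᴴ * L) j j).im = 0 := fun j =>
      ((Complex.le_def.1 (p2.diag_nonneg (i := j))).2).symm
    have key : ∀ (M1 : Matrix (Fin N) (Fin N) ℂ) (M2 : Matrix (Fin N) (Fin N) ℂ) (i j : Fin N),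
        (M1 * Matrix.single j i 1 * M2 * Matrix.single i j 1).trace = M1 j j * M2 i i := by
      intro M1 M2 i j
      rw [Matrix.trace_mul_comm, Matrix.mul_assoc M1, ← Matrix.mul_assoc,
        ← Matrix.mul_assoc]
      simp [Matrix.trace, Matrix.mul_apply, Matrix.single_apply, Finset.sum_ite_eq, ite_and,
        Finset.sum_mul, Finset.mul_sum]
    have hij : ∀ i j, ((Lᴴ * A * L) j j).re * ((R * Rᴴ) i i).re ≤
        ((Lᴴ * L) j j).re * ((R * (Xᴴ * A * X) * Rᴴ) i i).re := by
      intro i j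
      have h := hso2 (L * Matrix.single j i 1 * R) (by
        rw [← Matrix.mul_assoc, ← Matrix.mul_assoc, hXL]; simp)
      have cs : (Matrix.single j i (1:ℂ))ᴴ = Matrix.single i j 1 := by simp
      have s1 : ((L * Matrix.single j i 1 * R)ᴴ * A * (L * Matrix.single j i 1 * R)).trace
          = (Lᴴ * A * L) j j * (R * Rᴴ) i i := by
        rw [← key, conjTranspose_mul, conjTranspose_mul, cs]
        calc _ = (Rᴴ * (Matrix.single i j 1 * Lᴴ * A * L * Matrix.single j i 1 * R)).trace := by
              simp only [Matrix.mul_assoc]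
          _ = ((Matrix.single i j 1 * Lᴴ * A * L * Matrix.single j i 1 * R) * Rᴴ).trace :=
              Matrix.trace_mul_comm _ _
          _ = (Matrix.single i j 1 * (Lᴴ * A * L * Matrix.single j i 1 * (R * Rᴴ))).trace := by
              simp only [Matrix.mul_assoc]
          _ = _ := Matrix.trace_mul_comm _ _
      have s2 : ((L * Matrix.single j i 1 * R) * (Xᴴ * A * X) *
          (L * Matrix.single j i 1 * R)ᴴ).trace
          = (Lᴴ * L) j j * (R * (Xᴴ * A * X) * Rᴴ) i i := by
        rw [← key, conjTranspose_mul, conjTranspose_mul, cs]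
        calc _ = ((L * Matrix.single j i 1 * (R * (Xᴴ * A * X) * Rᴴ) * Matrix.single i j 1)
                * Lᴴ).trace := by simp only [Matrix.mul_assoc]
          _ = (Lᴴ * (L * Matrix.single j i 1 * (R * (Xᴴ * A * X) * Rᴴ) *
                Matrix.single i j 1)).trace := Matrix.trace_mul_comm _ _
          _ = _ := by simp only [Matrix.mul_assoc]
      rw [s1, s2, Complex.mul_re, Complex.mul_re, im1, im2] at h
      simpa using h
    simp only [Matrix.trace, Matrix.diag_apply, Complex.re_sum, Finset.sum_mul_sum]
    exact Finset.sum_le_sum fun j _ => Finset.sum_le_sum fun i _ => hij i j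
  have hc0 := quad_nonneg hneg L
  have hb0 : 0 ≤ (Lᴴ * L).trace.re := by
    have := quad_nonneg Matrix.PosDef.one L
    rwa [Matrix.mul_one] at this
  have ha0 : 0 ≤ (R * (Xᴴ * A * X) * Rᴴ).trace.re := by
    have := quad_nonneg hneg (X * Rᴴ)
    rw [conjTranspose_mul, conjTranspose_conjTranspose] at this
    simpa only [Matrix.mul_assoc] using this
  have hQQ : (1 - X * Xᴴ) * (1 - X * Xᴴ) = 1 - X * Xᴴ := by
    rw [Matrix.sub_mul, Matrix.mul_sub (X * Xᴴ), hPP]; simp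
  have hQH : (1 - X * Xᴴ)ᴴ = 1 - X * Xᴴ := by rw [conjTranspose_sub, hPH]; simp
  have hTc : (1 - T) * (1 - T) = 1 - T := by
    rw [Matrix.sub_mul, Matrix.mul_sub T, hTT]; simp
  have hTcH : (1 - T)ᴴ = 1 - T := by rw [conjTranspose_sub, hT]; simp
  have hLL : L * Lᴴ = (1 - X * Xᴴ) * T * (1 - X * Xᴴ) := by
    rw [hL, conjTranspose_mul, hQH, hT]
    calc _ = (1 - X * Xᴴ) * (T * T) * (1 - X * Xᴴ) := by simp only [Matrix.mul_assoc]
      _ = _ := by rw [hTT]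
  have hb : (Lᴴ * L).trace = T.trace - (X * Xᴴ * T).trace := by
    rw [Matrix.trace_mul_comm, hLL, Matrix.trace_mul_comm, ← Matrix.mul_assoc, hQQ,
      Matrix.sub_mul, Matrix.trace_sub, Matrix.one_mul]
  have hd : (R * Rᴴ).trace = m - (X * Xᴴ * T).trace := by
    rw [hR, conjTranspose_mul, hTcH, Matrix.mul_assoc, Matrix.trace_mul_comm]
    calc _ = (X * Xᴴ * ((1 - T) * (1 - T))).trace := by simp only [Matrix.mul_assoc]
      _ = _ := by
        rw [hTc, Matrix.mul_sub, Matrix.trace_sub, Matrix.mul_one, Matrix.trace_mul_comm, hS1]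
        simp
  have hc : (Lᴴ * A * L).trace = (A * T).trace - (A * (X * Xᴴ) * T).trace := by
    have hAQ : (1 - X * Xᴴ) * A = A * (1 - X * Xᴴ) := by
      rw [Matrix.sub_mul, Matrix.mul_sub, hcomm]; simp
    rw [Matrix.mul_assoc, Matrix.trace_mul_comm, Matrix.mul_assoc, hLL, ← Matrix.mul_assoc,
      Matrix.trace_mul_comm, ← Matrix.mul_assoc, ← Matrix.mul_assoc, hAQ, Matrix.mul_assoc A, hQQ,
      Matrix.mul_sub, Matrix.mul_one, Matrix.sub_mul, Matrix.trace_sub]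
  have ha : (R * (Xᴴ * A * X) * Rᴴ).trace = (A * (X * Xᴴ)).trace - (A * (X * Xᴴ) * T).trace := by
    have hPAP : X * (Xᴴ * A * X) * Xᴴ = A * (X * Xᴴ) := by
      calc _ = X * Xᴴ * A * X * Xᴴ := by simp only [Matrix.mul_assoc]
        _ = _ := by rw [hPAX, Matrix.mul_assoc]
    rw [hR, conjTranspose_mul, hTcH]
    calc _ = ((1 - T) * (X * (Xᴴ * A * X) * Xᴴ * (1 - T))).trace := by
          simp only [Matrix.mul_assoc]
      _ = _ := by
        rw [hPAP, Matrix.trace_mul_comm, Matrix.mul_assoc, hTc, Matrix.mul_sub, Matrix.mul_one,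
          Matrix.trace_sub]
  have hle : (Lᴴ * A * L).trace.re ≤ (R * (Xᴴ * A * X) * Rᴴ).trace.re := by
    have hdb : (Lᴴ * L).trace.re ≤ (R * Rᴴ).trace.re := by
      rw [hb, hd]; simpa using hTm
    rcases hb0.eq_or_lt with h0 | hpos
    · have : L = 0 := by
        apply quad_zero Matrix.PosDef.one
        rw [Matrix.mul_one]; exact h0.symm.le
      rw [this] at hc0 ⊢
      simpa using ha0
    · have := mul_le_mul_of_nonneg_left hdb hc0
      have h3 : (Lᴴ * L).trace.re * (Lᴴ * A * L).trace.re ≤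
        (Lᴴ * L).trace.re * (R * (Xᴴ * A * X) * Rᴴ).trace.re := by linarith
      exact le_of_mul_le_mul_left h3 hpos
  rw [ha, hc, Complex.sub_re, Complex.sub_re] at hle
  rw [hPP] at hE
  linarith
end

section
/- The OMM functional E₀ attains a global minimum on ℂ^{N×m}, and its minimum value equals λ₁ + λ₂ + ⋯ + λ_m, the sum of the m most negative eigenvalues of H. -/
open Matrix
open scoped ComplexOrder

attribute [local instance] Matrix.frobeniusSeminormedAddCommGroup
  Matrix.frobeniusNormedAddCommGroup Matrix.frobeniusNormedSpace

lemma E0_unitary {N m : ℕ} (H U : Matrix (Fin N) (Fin N) ℂ) (L : Matrix (Fin N) (Fin N) ℂ)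
    (hU : Uᴴ * U = 1) (hH : H = U * L * Uᴴ) (Y : Matrix (Fin N) (Fin m) ℂ) :
    E0 H (U * Y) = E0 L Y := by
  unfold E0
  have h1 : (U * Y)ᴴ * (U * Y) = Yᴴ * Y := by
    rw [conjTranspose_mul, Matrix.mul_assoc, ← Matrix.mul_assoc Uᴴ, hU, Matrix.one_mul]
  have h2 : (U * Y)ᴴ * H * (U * Y) = Yᴴ * L * Y := by
    have : (U * Y)ᴴ * H * (U * Y) = Yᴴ * (Uᴴ * U) * L * (Uᴴ * U) * Y := by
      rw [hH, conjTranspose_mul]; simp only [Matrix.mul_assoc]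
    rw [this, hU]; simp
  rw [h1, h2]

/-- the weights -/
noncomputable def dW {N m : ℕ} (Y : Matrix (Fin N) (Fin m) ℂ) (i : Fin N) : ℝ :=
  2 * ((Y * Yᴴ) i i).re - ∑ j, ‖(Y * Yᴴ) i j‖ ^ 2

lemma mul_self_diag {N : ℕ} (Q : Matrix (Fin N) (Fin N) ℂ) (hQ : Q.IsHermitian) (i : Fin N) :
    (Q * Q) i i = ((∑ j, ‖Q i j‖ ^ 2 : ℝ) : ℂ) := by
  rw [Matrix.mul_apply]
  push_cast
  refine Finset.sum_congr rfl fun j _ => ?_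
  rw [← hQ.apply j i, ← Complex.mul_conj']
  rfl

lemma E0_diag {N m : ℕ} (lam : Fin N → ℝ) (Y : Matrix (Fin N) (Fin m) ℂ) :
    E0 (diagonal fun i => (lam i : ℂ)) Y = ∑ i, lam i * dW Y i := by
  unfold E0
  set L : Matrix (Fin N) (Fin N) ℂ := diagonal fun i => (lam i : ℂ)
  have h1 : (((2 : ℂ) • (1 : Matrix (Fin m) (Fin m) ℂ) - Yᴴ * Y) * (Yᴴ * L * Y)).trace
      = (L * ((2 : ℂ) • (Y * Yᴴ) - (Y * Yᴴ) * (Y * Yᴴ))).trace := by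
    rw [Matrix.sub_mul, Matrix.mul_sub, trace_sub, trace_sub]
    congr 1
    · rw [Matrix.smul_mul, Matrix.one_mul, Matrix.mul_smul, trace_smul, trace_smul,
        Matrix.mul_assoc, trace_mul_comm, Matrix.mul_assoc]
    · have : Yᴴ * Y * (Yᴴ * L * Y) = (Yᴴ * Y * Yᴴ) * (L * Y) := by
        simp only [Matrix.mul_assoc]
      rw [this, trace_mul_comm]
      simp only [Matrix.mul_assoc]
  rw [h1]
  simp only [trace, diag_apply, L, diagonal_mul, Complex.re_sum, dW]
  refine Finset.sum_congr rfl fun i _ => ?_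
  rw [Matrix.sub_apply, mul_self_diag _ (isHermitian_mul_conjTranspose_self Y)]
  simp [-Complex.ofReal_sum]

lemma dW_le_one {N m : ℕ} (Y : Matrix (Fin N) (Fin m) ℂ) (i : Fin N) : dW Y i ≤ 1 := by
  unfold dW
  have h1 : ‖(Y * Yᴴ) i i‖ ^ 2 ≤ ∑ j, ‖(Y * Yᴴ) i j‖ ^ 2 :=
    Finset.single_le_sum (f := fun j => ‖(Y * Yᴴ) i j‖ ^ 2) (fun j _ => by positivity)
      (Finset.mem_univ i)
  have h2 := Complex.re_le_norm ((Y * Yᴴ) i i)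
  nlinarith [sq_nonneg (‖(Y * Yᴴ) i i‖ - 1)]

lemma sum_dW_le {N m : ℕ} (Y : Matrix (Fin N) (Fin m) ℂ) : ∑ i, dW Y i ≤ m := by
  have h1 : ((∑ i, dW Y i : ℝ) : ℂ) =
      ((2 : ℂ) • (Y * Yᴴ) - (Y * Yᴴ) * (Y * Yᴴ)).trace := by
    have hq := isHermitian_mul_conjTranspose_self Y
    simp only [trace, diag_apply, dW, Complex.ofReal_sum]
    refine Finset.sum_congr rfl fun i _ => ?_
    rw [Matrix.sub_apply, mul_self_diag _ hq, Complex.ofReal_sub, Complex.ofReal_mul]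
    have : (((Y * Yᴴ) i i).re : ℂ) = (Y * Yᴴ) i i := hq.coe_re_apply_self i
    rw [this]; simp
  have hk : (1 - Yᴴ * Y).IsHermitian :=
    isHermitian_one.sub (isHermitian_conjTranspose_mul_self Y)
  have h2 : ((2 : ℂ) • (Y * Yᴴ) - (Y * Yᴴ) * (Y * Yᴴ)).trace
      = (m : ℂ) - ((1 - Yᴴ * Y) * (1 - Yᴴ * Y)).trace := by
    have e1 : (Y * Yᴴ).trace = (Yᴴ * Y).trace := trace_mul_comm _ _
    have e2 : (Y * Yᴴ * (Y * Yᴴ)).trace = (Yᴴ * Y * (Yᴴ * Y)).trace := by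
      rw [Matrix.mul_assoc, trace_mul_comm]; simp only [Matrix.mul_assoc]
    have e3 : (1 - Yᴴ * Y) * (1 - Yᴴ * Y) = 1 - (2 : ℂ) • (Yᴴ * Y) + Yᴴ * Y * (Yᴴ * Y) := by
      rw [two_smul]; noncomm_ring
    rw [e3, trace_sub, trace_add, trace_sub, trace_smul, trace_smul, e1, e2]
    simp
    ring
  have h3 : ((1 - Yᴴ * Y) * (1 - Yᴴ * Y)).trace
      = ((∑ i, ∑ j, ‖(1 - Yᴴ * Y : Matrix (Fin m) (Fin m) ℂ) i j‖ ^ 2 : ℝ) : ℂ) := by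
    rw [trace, Complex.ofReal_sum]
    exact Finset.sum_congr rfl fun i _ => mul_self_diag _ hk i
  rw [h2, h3] at h1
  have h4 : ∑ i, dW Y i = m - ∑ i, ∑ j, ‖(1 - Yᴴ * Y : Matrix (Fin m) (Fin m) ℂ) i j‖ ^ 2 := by exact_mod_cast h1
  have h5 : 0 ≤ ∑ i, ∑ j, ‖(1 - Yᴴ * Y : Matrix (Fin m) (Fin m) ℂ) i j‖ ^ 2 := by positivity
  linarith

lemma sum_dW_subset_le {N m : ℕ} (Y : Matrix (Fin N) (Fin m) ℂ) (T : Finset (Fin N)) :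
    ∑ i ∈ T, dW Y i ≤ m := by
  classical
  set Z : Matrix (Fin N) (Fin m) ℂ :=
    Matrix.of fun i j => if i ∈ T then Y i j else 0 with hZ
  have hq : ∀ i j, (Z * Zᴴ) i j = if i ∈ T ∧ j ∈ T then (Y * Yᴴ) i j else 0 := by
    intro i j
    rw [Matrix.mul_apply, Matrix.mul_apply]
    simp only [conjTranspose_apply, hZ, Matrix.of_apply]
    by_cases hi : i ∈ T <;> by_cases hj : j ∈ T <;> simp [hi, hj]
  refine le_trans ?_ (sum_dW_le Z)
  rw [← Finset.sum_subset (Finset.subset_univ T)]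
  · refine Finset.sum_le_sum fun i hi => ?_
    unfold dW
    have : ∑ j, ‖(Z * Zᴴ) i j‖ ^ 2 ≤ ∑ j, ‖(Y * Yᴴ) i j‖ ^ 2 := by
      refine Finset.sum_le_sum fun j _ => ?_
      rw [hq]; split_ifs
      · exact le_rfl
      · simp
    rw [hq i i, if_pos ⟨hi, hi⟩]
    linarith
  · intro i _ hi
    simp [dW, hq, hi]

lemma sum_castLE {N m : ℕ} (hmN : m ≤ N) (f : Fin N → ℝ) :
    ∑ i : Fin N, (if i.val < m then f i else 0) = ∑ i : Fin m, f (Fin.castLE hmN i) := by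
  rw [← Finset.sum_filter]
  symm
  refine Finset.sum_bij (fun i _ => Fin.castLE hmN i) ?_ ?_ ?_ ?_
  · intro i _; simp
  · intro i _ j _ h; exact Fin.castLE_injective hmN h
  · intro i hi
    exact ⟨⟨i.val, by simpa using hi⟩, Finset.mem_univ _, rfl⟩
  · intro i _; rfl

lemma bathtub {N m : ℕ} (hm : 0 < m) (hmN : m ≤ N) (lam : Fin N → ℝ) (hmono : Monotone lam)
    (hneg : ∀ i, lam i ≤ 0) (d : Fin N → ℝ) (hd : ∀ i, d i ≤ 1)
    (hs : ∀ T : Finset (Fin N), ∑ i ∈ T, d i ≤ m) :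
    ∑ i : Fin N, (if i.val < m then lam i else 0) ≤ ∑ i, lam i * d i := by
  classical
  have hs' : ∑ i, max (d i) 0 ≤ m := by
    refine le_trans (le_of_eq ?_) (hs (Finset.univ.filter fun i => 0 < d i))
    rw [Finset.sum_filter]
    refine Finset.sum_congr rfl fun i _ => ?_
    split_ifs with h
    · exact max_eq_left h.le
    · exact max_eq_right (not_lt.1 h)
  set c : ℝ := lam ⟨m - 1, by omega⟩ with hc
  have hcard : ∑ i : Fin N, (if i.val < m then (1 : ℝ) else 0) = m := by
    rw [sum_castLE hmN (fun _ => 1)]; simp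
  have key : ∀ i : Fin N, (if i.val < m then lam i else 0) + c * max (d i) 0
      - c * (if i.val < m then (1 : ℝ) else 0) ≤ lam i * d i := by
    intro i
    have h1 : max (d i) 0 ≤ 1 := max_le (hd i) zero_le_one
    have h0 : 0 ≤ max (d i) 0 := le_max_right _ _
    have h2 : lam i * max (d i) 0 ≤ lam i * d i :=
      mul_le_mul_of_nonpos_left (le_max_left _ _) (hneg i)
    split_ifs with h
    · have : lam i ≤ c := hmono (by rw [Fin.le_def]; simp; omega)
      nlinarith
    · have : c ≤ lam i := hmono (by rw [Fin.le_def]; simp; omega)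
      nlinarith
  have hsum := Finset.sum_le_sum fun i (_ : i ∈ Finset.univ) => key i
  rw [Finset.sum_sub_distrib, Finset.sum_add_distrib, ← Finset.mul_sum, ← Finset.mul_sum,
    hcard] at hsum
  have hc0 : c ≤ 0 := hneg _
  nlinarith


lemma exists_diag {N : ℕ} (H : Matrix (Fin N) (Fin N) ℂ) (hH : H.IsHermitian)
    (lam : Fin N → ℝ) (hmono : Monotone lam)
    (hchar : H.charpoly = ∏ i : Fin N, (Polynomial.X - Polynomial.C (lam i : ℂ))) :
    ∃ U : Matrix (Fin N) (Fin N) ℂ, Uᴴ * U = 1 ∧ U * Uᴴ = 1 ∧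
      H = U * (diagonal fun i => (lam i : ℂ)) * Uᴴ := by
  set σ := Tuple.sort hH.eigenvalues with hσ
  have hms : Multiset.map hH.eigenvalues Finset.univ.val = Multiset.map lam Finset.univ.val := by
    have h1 := hH.roots_charpoly_eq_eigenvalues
    have h2 : H.charpoly.roots = Multiset.map (fun i => (lam i : ℂ)) Finset.univ.val := by
      rw [hchar, Polynomial.roots_prod]
      · simp
      · simp [Finset.prod_ne_zero_iff, Polynomial.X_sub_C_ne_zero]
    rw [h1] at h2
    have h3 := congrArg (Multiset.map Complex.re) h2
    simpa [Multiset.map_map, Function.comp_def] using h3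
  have hs : hH.eigenvalues ∘ σ = lam := by
    apply List.ofFn_injective
    have hp : (List.ofFn (hH.eigenvalues ∘ σ)).Perm (List.ofFn lam) := by
      refine (Equiv.Perm.ofFn_comp_perm σ hH.eigenvalues).trans ?_
      rw [← Multiset.coe_eq_coe]
      simpa [Fin.univ_val_map] using hms
    exact hp.eq_of_sortedLE (Tuple.monotone_sort hH.eigenvalues).sortedLE_ofFn
      hmono.sortedLE_ofFn
  set V : Matrix (Fin N) (Fin N) ℂ := (hH.eigenvectorUnitary).1 with hV
  have hV1 : Vᴴ * V = 1 := Unitary.coe_star_mul_self hH.eigenvectorUnitary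
  have hV2 : V * Vᴴ = 1 := Unitary.coe_mul_star_self hH.eigenvectorUnitary
  have hsp : H = V * diagonal (fun i => (hH.eigenvalues i : ℂ)) * Vᴴ := by
    have := hH.spectral_theorem
    rw [Unitary.conjStarAlgAut_apply] at this
    exact this
  refine ⟨V.submatrix id σ, ?_, ?_, ?_⟩
  · rw [conjTranspose_submatrix, submatrix_mul _ _ _ id _ Function.bijective_id |>.symm, hV1]
    simp
  · rw [conjTranspose_submatrix, submatrix_mul _ _ _ σ _ σ.bijective |>.symm, hV2]
    simp
  · have hd : (diagonal fun i => (lam i : ℂ)) =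
        (diagonal fun i => (hH.eigenvalues i : ℂ)).submatrix σ σ := by
      rw [submatrix_diagonal_equiv, ← hs]; rfl
    rw [hd, conjTranspose_submatrix, submatrix_mul _ _ _ σ _ σ.bijective |>.symm,
      submatrix_mul _ _ _ σ _ σ.bijective |>.symm, ← hsp]
    simp

lemma dW_first {N m : ℕ} (hmN : m ≤ N) (i : Fin N) :
    dW (Matrix.of fun (i : Fin N) (j : Fin m) => if i.val = j.val then (1 : ℂ) else 0) i
      = if i.val < m then 1 else 0 := by
  set Y : Matrix (Fin N) (Fin m) ℂ :=
    (Matrix.of fun (i : Fin N) (j : Fin m) => if i.val = j.val then (1 : ℂ) else 0) with hY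
  have hq : ∀ i j, (Y * Yᴴ) i j = if i = j ∧ i.val < m then 1 else 0 := by
    intro i j
    rw [Matrix.mul_apply]
    simp only [conjTranspose_apply, hY, Matrix.of_apply]
    by_cases hi : i.val < m
    · rw [Finset.sum_eq_single ⟨i.val, hi⟩]
      · by_cases hj : i = j
        · subst hj; simp [hi]
        · have : ¬ (j.val = i.val) := fun h => hj (Fin.ext h.symm)
          simp [hj, this]
      · intro k _ hk
        have : ¬ (i.val = k.val) := fun h => hk (Fin.ext h.symm)
        simp [this]
      · simp
    · rw [Finset.sum_eq_zero]
      · simp [hi]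
      · intro k _
        have : ¬ (i.val = k.val) := by omega
        simp [this]
  unfold dW
  rw [Finset.sum_eq_single i]
  · rw [hq]
    by_cases hi : i.val < m
    · simp [hi]; norm_num
    · simp [hi]
  · intro j _ hj
    rw [hq, if_neg (fun h => hj h.1.symm)]; simp
  · simp

/-- `E₀` attains a global minimum, whose value is the sum `λ₁ + ⋯ + λ_m` of the `m`
most negative eigenvalues of `H` (eigenvalues listed in increasing order with
multiplicity via the characteristic polynomial). -/
theorem stmt1 {N m : ℕ} (hN : 0 < N) (hm : 0 < m) (hmN : m ≤ N)
    (H : Matrix (Fin N) (Fin N) ℂ) (hH : H.IsHermitian) (hneg : (-H).PosDef)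
    (lam : Fin N → ℝ) (hmono : Monotone lam)
    (hchar : H.charpoly = ∏ i : Fin N, (Polynomial.X - Polynomial.C (lam i : ℂ))) :
    ∃ X : Matrix (Fin N) (Fin m) ℂ,
      (∀ Y : Matrix (Fin N) (Fin m) ℂ, E0 H X ≤ E0 H Y) ∧
      E0 H X = ∑ i : Fin m, lam (Fin.castLE hmN i) := by
  obtain ⟨U, hU1, hU2, hHU⟩ := exists_diag H hH lam hmono hchar
  have hlam : ∀ i, lam i ≤ 0 := by
    intro i
    have h1 := (hneg.posSemidef.conjTranspose_mul_mul_same U).diag_nonneg (i := i)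
    have h2 : Uᴴ * (-H) * U = -(diagonal fun i => (lam i : ℂ)) := by
      have : Uᴴ * (-H) * U = -((Uᴴ * U) * (diagonal fun i => (lam i : ℂ)) * (Uᴴ * U)) := by
        rw [hHU, Matrix.mul_neg, Matrix.neg_mul]; simp only [Matrix.mul_assoc]
      rw [this, hU1]; simp
    rw [h2, Matrix.neg_apply, diagonal_apply_eq] at h1
    have h3 : (0 : ℂ) ≤ ((-lam i : ℝ) : ℂ) := by simpa using h1
    have h4 : 0 ≤ -lam i := by exact_mod_cast h3
    linarith
  have hval : E0 H (U * (Matrix.of fun (i : Fin N) (j : Fin m) => if i.val = j.val then (1 : ℂ) else 0)) = ∑ i : Fin m, lam (Fin.castLE hmN i) := by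
    rw [E0_unitary H U _ hU1 hHU, E0_diag, ← sum_castLE hmN lam]
    refine Finset.sum_congr rfl fun i _ => ?_
    rw [dW_first hmN]; simp
  refine ⟨_, fun Y => ?_, hval⟩
  rw [hval, ← sum_castLE hmN lam]
  have hY : Y = U * (Uᴴ * Y) := by rw [← Matrix.mul_assoc, hU2, Matrix.one_mul]
  rw [hY, E0_unitary H U _ hU1 hHU, E0_diag]
  exact bathtub hm hmN lam hmono hlam _ (dW_le_one _) (sum_dW_subset_le _)
end

section
/- The OMM functional E₀ is real-differentiable on ℂ^{N×m} (viewed as a real vector space), and for every X, V ∈ ℂ^{N×m} its Fréchet derivative at X applied to V equals Re tr[V*(4HX − 2XX*HX − 2HXX*X)]. Consequently, the Fréchet derivative of E₀ at X vanishes if and only if 2HX − XX*HX − HXX*X = 0. -/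
open Matrix
open scoped ComplexOrder

attribute [local instance] Matrix.frobeniusSeminormedAddCommGroup
  Matrix.frobeniusNormedAddCommGroup Matrix.frobeniusNormedSpace

lemma E0_diff {N m : ℕ} (H : Matrix (Fin N) (Fin N) ℂ) (X : Matrix (Fin N) (Fin m) ℂ) :
    DifferentiableAt ℝ (E0 H) X := by
  have e : ∀ i j, Differentiable ℝ (fun X : Matrix (Fin N) (Fin m) ℂ => X i j) := by
    intro i j
    exact (LinearMap.toContinuousLinearMap (Matrix.entryLinearMap ℝ ℂ i j)).differentiable
  have e' : ∀ i j, Differentiable ℝ (fun X : Matrix (Fin N) (Fin m) ℂ => star (X i j)) := by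
    intro i j
    exact (Complex.conjCLE.differentiable).comp (e i j)
  have key : Differentiable ℝ (fun X : Matrix (Fin N) (Fin m) ℂ =>
      (((2 : ℂ) • (1 : Matrix (Fin m) (Fin m) ℂ) - Xᴴ * X) * (Xᴴ * H * X)).trace) := by
    simp only [Matrix.trace, Matrix.diag, Matrix.mul_apply, Matrix.sub_apply,
      Matrix.conjTranspose_apply]
    fun_prop
  exact (Complex.reCLM.differentiable.comp key) X

lemma poly_deriv {m : ℕ} (S0 S1 S2 T0 T1 T2 : Matrix (Fin m) (Fin m) ℂ) :
    HasDerivAt (fun t : ℝ => ((S0 + (t : ℂ) • S1 + ((t : ℂ) * t) • S2) *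
      (T0 + (t : ℂ) • T1 + ((t : ℂ) * t) • T2)).trace.re)
      ((S0 * T1).trace.re + (S1 * T0).trace.re) 0 := by
  have : (fun t : ℝ => ((S0 + (t : ℂ) • S1 + ((t : ℂ) * t) • S2) *
      (T0 + (t : ℂ) • T1 + ((t : ℂ) * t) • T2)).trace.re) = fun t : ℝ =>
      (S0 * T0).trace.re + t * ((S0 * T1).trace.re + (S1 * T0).trace.re)
      + t ^ 2 * ((S0 * T2).trace.re + (S1 * T1).trace.re + (S2 * T0).trace.re
        + t * ((S1 * T2).trace.re + (S2 * T1).trace.re) + t ^ 2 * (S2 * T2).trace.re) := by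
    funext t
    simp only [add_mul, mul_add, Matrix.smul_mul, Matrix.mul_smul, trace_add, trace_smul,
      Complex.add_re, smul_eq_mul, mul_assoc, Complex.re_ofReal_mul]
    ring
  rw [this]
  generalize (S0 * T0).trace.re = a
  generalize (S0 * T1).trace.re + (S1 * T0).trace.re = b
  generalize (S0 * T2).trace.re + (S1 * T1).trace.re + (S2 * T0).trace.re = c
  generalize (S1 * T2).trace.re + (S2 * T1).trace.re = d
  generalize (S2 * T2).trace.re = e
  have h := hasDerivAt_id (0 : ℝ)
  have h2 := ((h.mul_const b).const_add a).add
    ((h.pow 2).mul (((h.mul_const d).const_add c).add ((h.pow 2).mul_const e)))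
  exact h2.congr_deriv (by simp)

lemma re_conj {n : ℕ} (A : Matrix (Fin n) (Fin n) ℂ) : Aᴴ.trace.re = A.trace.re := by
  rw [Matrix.trace_conjTranspose]; simp

lemma E0_fderiv {N m : ℕ} (H : Matrix (Fin N) (Fin N) ℂ) (hH : H.IsHermitian)
    (X V : Matrix (Fin N) (Fin m) ℂ) :
    fderiv ℝ (E0 H) X V =
        (Vᴴ * ((4 : ℂ) • (H * X) - (2 : ℂ) • (X * Xᴴ * H * X)
          - (2 : ℂ) • (H * X * Xᴴ * X))).trace.re := by
  have h1 : HasDerivAt (fun t : ℝ => E0 H (X + t • V)) (fderiv ℝ (E0 H) X V) 0 :=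
    (E0_diff H X).hasFDerivAt.hasLineDerivAt V
  have h2 := poly_deriv ((2 : ℂ) • (1 : Matrix (Fin m) (Fin m) ℂ) - Xᴴ * X)
    (-(Xᴴ * V + Vᴴ * X)) (-(Vᴴ * V)) (Xᴴ * H * X) (Xᴴ * H * V + Vᴴ * H * X) (Vᴴ * H * V)
  have h3 : (fun t : ℝ => E0 H (X + t • V)) = (fun t : ℝ =>
      (((2 : ℂ) • (1 : Matrix (Fin m) (Fin m) ℂ) - Xᴴ * X + (t : ℂ) • (-(Xᴴ * V + Vᴴ * X))
        + ((t : ℂ) * t) • (-(Vᴴ * V))) *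
      (Xᴴ * H * X + (t : ℂ) • (Xᴴ * H * V + Vᴴ * H * X)
        + ((t : ℂ) * t) • (Vᴴ * H * V))).trace.re) := by
    funext t
    have ht : X + t • V = X + (t : ℂ) • V := by
      ext i j; simp
    have hs : star (t : ℂ) = t := Complex.conj_ofReal t
    rw [ht, E0]
    congr 3
    · simp only [conjTranspose_add, conjTranspose_smul, hs, Matrix.add_mul, Matrix.mul_add,
        Matrix.smul_mul, Matrix.mul_smul, smul_smul]
      module
    · simp only [conjTranspose_add, conjTranspose_smul, hs, Matrix.add_mul, Matrix.mul_add,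
        Matrix.smul_mul, Matrix.mul_smul, smul_smul]
      module
  rw [h3] at h1
  rw [h1.unique h2]
  have a1 : (Xᴴ * (H * V)).trace.re = (Vᴴ * (H * X)).trace.re := by
    rw [← re_conj]
    simp only [conjTranspose_mul, conjTranspose_conjTranspose, hH.eq, Matrix.mul_assoc]
  have a2 : (Xᴴ * (V * (Xᴴ * (H * X)))).trace.re = (Vᴴ * (X * (Xᴴ * (H * X)))).trace.re := by
    rw [← re_conj]
    simp only [conjTranspose_mul, conjTranspose_conjTranspose, hH.eq, Matrix.mul_assoc]
    rw [← Matrix.mul_assoc H, ← Matrix.mul_assoc Xᴴ, Matrix.trace_mul_comm]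
    simp only [Matrix.mul_assoc]
  have a3 : (Xᴴ * (X * (Xᴴ * (H * V)))).trace.re = (Vᴴ * (H * (X * (Xᴴ * X)))).trace.re := by
    rw [← re_conj]
    simp only [conjTranspose_mul, conjTranspose_conjTranspose, hH.eq, Matrix.mul_assoc]
  have a4 : (Xᴴ * (X * (Vᴴ * (H * X)))).trace.re = (Vᴴ * (H * (X * (Xᴴ * X)))).trace.re := by
    rw [← Matrix.mul_assoc Xᴴ, Matrix.trace_mul_comm]
    simp only [Matrix.mul_assoc]
  simp only [Matrix.add_mul, Matrix.mul_add, Matrix.sub_mul, Matrix.mul_sub, Matrix.neg_mul,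
    Matrix.smul_mul, Matrix.mul_smul, Matrix.one_mul, Matrix.mul_assoc, trace_add, trace_sub,
    trace_neg, trace_smul, Complex.add_re, Complex.sub_re, Complex.neg_re, smul_eq_mul,
    Complex.mul_re, Complex.re_ofNat, Complex.im_ofNat, zero_mul, sub_zero, a1, a2, a3, a4]
  ring

/-- `E₀` is real-differentiable, its Fréchet derivative at `X` in direction `V` is
`Re tr[V*(4HX − 2XX*HX − 2HXX*X)]`, and it vanishes iff
`2HX − XX*HX − HXX*X = 0`. -/
theorem stmt5 {N m : ℕ} (hN : 0 < N) (hm : 0 < m) (hmN : m ≤ N)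
    (H : Matrix (Fin N) (Fin N) ℂ) (hH : H.IsHermitian) (hneg : (-H).PosDef) :
    (∀ X : Matrix (Fin N) (Fin m) ℂ, DifferentiableAt ℝ (E0 H) X) ∧
    (∀ X V : Matrix (Fin N) (Fin m) ℂ,
      fderiv ℝ (E0 H) X V =
        (Vᴴ * ((4 : ℂ) • (H * X) - (2 : ℂ) • (X * Xᴴ * H * X)
          - (2 : ℂ) • (H * X * Xᴴ * X))).trace.re) ∧
    (∀ X : Matrix (Fin N) (Fin m) ℂ,
      fderiv ℝ (E0 H) X = 0 ↔
        (2 : ℂ) • (H * X) - X * Xᴴ * H * X - H * X * Xᴴ * X = 0) := by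
  refine ⟨E0_diff H, E0_fderiv H hH, fun X => ?_⟩
  have hG : (4 : ℂ) • (H * X) - (2 : ℂ) • (X * Xᴴ * H * X) - (2 : ℂ) • (H * X * Xᴴ * X)
      = (2 : ℂ) • ((2 : ℂ) • (H * X) - X * Xᴴ * H * X - H * X * Xᴴ * X) := by
    module
  constructor
  · intro h
    have h1 := E0_fderiv H hH X ((2 : ℂ) • (H * X) - X * Xᴴ * H * X - H * X * Xᴴ * X)
    rw [h, hG] at h1
    generalize (2 : ℂ) • (H * X) - X * Xᴴ * H * X - H * X * Xᴴ * X = G at h1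
    have hp := (Matrix.posSemidef_conjTranspose_mul_self G).trace_nonneg
    rw [Complex.le_def] at hp
    have h0 : (Gᴴ * G).trace.re = 0 := by
      simpa [Matrix.mul_smul, trace_smul] using h1.symm
    refine Matrix.trace_conjTranspose_mul_self_eq_zero_iff.mp (Complex.ext h0 hp.2.symm)
  · intro h
    ext V
    rw [E0_fderiv H hH, hG, h]
    simp
end

section
/- Suppose λ_m < λ_{m+1} and let α ∈ (0,1). Then there exists δ > 0 such that every X ∈ ℂ^{N×m} with d(X, S₀) < δ satisfies E₀(X) − min E₀ ≥ α(λ_{m+1} − λ_m)·d(X, S₀)², where d(X, S₀) = inf_{Y ∈ S₀} ‖X − Y‖_F. -/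
open Matrix
open scoped ComplexOrder

attribute [local instance] Matrix.frobeniusSeminormedAddCommGroup
  Matrix.frobeniusNormedAddCommGroup Matrix.frobeniusNormedSpace

theorem nsq {p q : Type*} [Fintype p] [Fintype q] (A : Matrix p q ℂ) :
    ‖A‖ ^ 2 = ∑ i, ∑ j, ‖A i j‖ ^ 2 := by
  rw [Matrix.frobenius_norm_def, ← Real.sqrt_eq_rpow, Real.sq_sqrt (by positivity)]
  simp

theorem nsq_tr {p q : Type*} [Fintype p] [Fintype q] (A : Matrix p q ℂ) :
    ‖A‖ ^ 2 = (Aᴴ * A).trace.re := by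
  rw [nsq, Finset.sum_comm]
  simp [Matrix.trace, Matrix.mul_apply, ← Complex.normSq_eq_conj_mul_self, Complex.normSq_eq_norm_sq, ← Complex.ofReal_pow]

theorem polar {p : Type*} [Fintype p] [DecidableEq p] (B : Matrix p p ℂ) (hB : IsUnit B) :
    ∃ W : Matrix p p ℂ, W * Wᴴ = 1 ∧ Wᴴ * W = 1 ∧ ‖B - W‖ ≤ ‖B * Bᴴ - 1‖ := by
  have hs : (B * Bᴴ).PosSemidef := Matrix.posSemidef_self_mul_conjTranspose B
  obtain ⟨P, hP, hPP⟩ : ∃ P : Matrix p p ℂ, P.PosSemidef ∧ P * P = B * Bᴴ := by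
    classical
    open scoped MatrixOrder in
    exact ⟨CFC.sqrt (B * Bᴴ), Matrix.nonneg_iff_posSemidef.1 (CFC.sqrt_nonneg _), CFC.sqrt_mul_sqrt_self _ hs.nonneg⟩
  have hPu : IsUnit P := by
    have h : IsUnit (P * P) := by
      rw [hPP]; exact hB.mul (by simpa using hB.star)
    rw [Matrix.isUnit_iff_isUnit_det] at h ⊢
    rw [Matrix.det_mul] at h
    exact isUnit_of_mul_isUnit_left h
  have hdet := (Matrix.isUnit_iff_isUnit_det P).1 hPu
  have hPh : Pᴴ = P := hP.1
  have hW1 : (P⁻¹ * B) * (P⁻¹ * B)ᴴ = 1 := by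
    rw [Matrix.conjTranspose_mul, Matrix.conjTranspose_nonsing_inv, hPh]
    calc P⁻¹ * B * (Bᴴ * P⁻¹) = P⁻¹ * (B * Bᴴ) * P⁻¹ := by simp only [Matrix.mul_assoc]
      _ = (P⁻¹ * P) * (P * P⁻¹) := by rw [← hPP]; simp only [Matrix.mul_assoc]
      _ = 1 := by rw [Matrix.nonsing_inv_mul _ hdet, Matrix.mul_nonsing_inv _ hdet, one_mul]
  refine ⟨P⁻¹ * B, hW1, mul_eq_one_comm.1 hW1, ?_⟩
  set W := P⁻¹ * B with hW
  have hBW : B = P * W := by rw [hW, ← Matrix.mul_assoc, Matrix.mul_nonsing_inv _ hdet, one_mul]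
  set M := P - 1 with hM
  have hMh : Mᴴ = M := by simp [hM, hPh]
  have e1 : B - W = M * W := by rw [hM, sub_mul, one_mul, ← hBW]
  have e2 : B * Bᴴ - 1 = M * P + M := by rw [← hPP, hM]; noncomm_ring
  apply abs_le_of_sq_le_sq' _ (norm_nonneg _) |>.2
  have f1 : ‖B - W‖ ^ 2 = (M * M).trace.re := by
    rw [nsq_tr, e1, Matrix.trace_mul_comm, Matrix.conjTranspose_mul, hMh]
    rw [show M * W * (Wᴴ * M) = M * (W * Wᴴ) * M by simp only [Matrix.mul_assoc], hW1, mul_one]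
  have f2 : ‖B * Bᴴ - 1‖ ^ 2 = ‖M * P‖ ^ 2 + 2 * (M * P * M).trace.re + (M * M).trace.re := by
    rw [nsq_tr, e2, nsq_tr (M * P), Matrix.conjTranspose_add, Matrix.conjTranspose_mul, hMh, hPh,
      add_mul, mul_add, mul_add]
    simp only [Matrix.trace_add, Complex.add_re]
    have g1 : (P * M * M).trace = (M * P * M).trace := by rw [Matrix.trace_mul_comm, Matrix.mul_assoc]
    have g2 : (M * (M * P)).trace = (M * P * M).trace := by rw [Matrix.trace_mul_comm]
    rw [g1, g2]; ring
  have f3 : 0 ≤ (M * P * M).trace.re := by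
    have := (hP.conjTranspose_mul_mul_same M).trace_nonneg
    rw [hMh] at this
    exact (Complex.le_def.1 this).1
  rw [f1, f2]; nlinarith [sq_nonneg ‖M * P‖]

/-- weighted residual -/
noncomputable def Rf {ι p : Type*} [Fintype ι] [DecidableEq ι] [Fintype p] (a : ι → ℝ)
    (X : Matrix ι p ℂ) : ℝ := ∑ i, a i * ∑ j, ‖(1 - X * Xᴴ : Matrix _ _ ℂ) i j‖ ^ 2

theorem kyfan {p q : Type*} [Fintype p] [Fintype q] [DecidableEq p] [DecidableEq q]
    (a : p ⊕ q → ℝ) (b c : ℝ) (hcb : c < b) (ha : ∀ i, 0 < a i)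
    (hb : ∀ i, b ≤ a (Sum.inl i)) (hc : ∀ j, a (Sum.inr j) ≤ c) (hc0 : 0 ≤ c)
    (X : Matrix (p ⊕ q) p ℂ) :
    ∑ j, a (Sum.inr j) ≤ Rf a X ∧ (Rf a X ≤ ∑ j, a (Sum.inr j) →
      ∀ i k, (1 - X * Xᴴ : Matrix _ _ ℂ) (Sum.inl i) k = 0) := by
  set K : Submodule ℂ (EuclideanSpace ℂ (p ⊕ q)) := LinearMap.ker (Matrix.toEuclideanLin Xᴴ) with hK
  let u := stdOrthonormalBasis ℂ K
  have hrank : Fintype.card q ≤ Module.finrank ℂ K := by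
    have h1 := LinearMap.finrank_range_add_finrank_ker (Matrix.toEuclideanLin Xᴴ)
    have h2 := Submodule.finrank_le (LinearMap.range (Matrix.toEuclideanLin Xᴴ))
    simp only [finrank_euclideanSpace, Fintype.card_sum] at h1 h2
    rw [hK]; omega
  have hu : Orthonormal ℂ (fun j => (u j : EuclideanSpace ℂ (p ⊕ q))) :=
    u.orthonormal.comp_linearIsometry K.subtypeₗᵢ
  set Q : p ⊕ q → ℝ := fun i => ∑ j, ‖(u j : EuclideanSpace ℂ (p ⊕ q)) i‖ ^ 2 with hQ
  have hQ0 : ∀ i, 0 ≤ Q i := fun i => by positivity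
  have hQ1 : ∀ i, Q i ≤ 1 := by
    intro i
    have := hu.sum_inner_products_le (s := Finset.univ) (EuclideanSpace.single i (1:ℂ))
    simpa [EuclideanSpace.inner_single_right] using this
  have hQs : ∑ i, Q i = Module.finrank ℂ K := by
    rw [hQ, Finset.sum_comm]
    have : ∀ j, ∑ i, ‖(u j : EuclideanSpace ℂ (p ⊕ q)) i‖ ^ 2 = 1 := by
      intro j
      rw [← EuclideanSpace.norm_sq_eq, hu.1 j]; simp
    simp [this]
  set r : p ⊕ q → ℝ := fun i => ∑ j, ‖(1 - X * Xᴴ : Matrix _ _ ℂ) i j‖ ^ 2 with hr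
  have hQr : ∀ i, Q i ≤ r i := by
    intro i
    have := hu.sum_inner_products_le (s := Finset.univ)
      (WithLp.toLp 2 (fun k => star ((1 - X * Xᴴ : Matrix _ _ ℂ) i k)))
    rw [EuclideanSpace.norm_sq_eq] at this
    simp only [norm_star] at this
    refine le_trans (le_of_eq ?_) this
    refine Finset.sum_congr rfl fun j _ => ?_
    have hk : Xᴴ *ᵥ (u j : EuclideanSpace ℂ (p ⊕ q)).ofLp = 0 := by
      have : (u j : EuclideanSpace ℂ (p ⊕ q)) ∈ LinearMap.ker (Matrix.toEuclideanLin Xᴴ) := (u j).2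
      rw [LinearMap.mem_ker] at this
      have h0 := congrArg WithLp.ofLp this
      exact h0
    have h2 : (1 - X * Xᴴ : Matrix _ _ ℂ) *ᵥ (u j : EuclideanSpace ℂ (p ⊕ q)).ofLp
        = (u j : EuclideanSpace ℂ (p ⊕ q)).ofLp := by
      rw [Matrix.sub_mulVec, ← Matrix.mulVec_mulVec, hk]; simp
    have h3 := congrFun h2 i
    rw [← h3, ← norm_star]
    congr 2
    simp [Matrix.mulVec, dotProduct, EuclideanSpace.inner_eq_star_dotProduct, mul_comm]
  have hRf : Rf a X = ∑ i, a i * r i := rfl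
  have hcard : (Fintype.card q : ℝ) ≤ ∑ i, Q i := by rw [hQs]; exact_mod_cast hrank
  have key : ∑ j, a (Sum.inr j) + ∑ i, a i * (r i - Q i) + (b - c) * ∑ i, Q (Sum.inl i) ≤ Rf a X := by
    have e1 : b * ∑ i, Q (Sum.inl i) ≤ ∑ i, a (Sum.inl i) * Q (Sum.inl i) := by
      rw [Finset.mul_sum]
      exact Finset.sum_le_sum fun i _ => mul_le_mul_of_nonneg_right (hb i) (hQ0 _)
    have e2 : ∑ j, a (Sum.inr j) - ∑ j, a (Sum.inr j) * Q (Sum.inr j)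
        ≤ c * (Fintype.card q - ∑ j, Q (Sum.inr j)) := by
      have : c * (Fintype.card q - ∑ j, Q (Sum.inr j)) = ∑ j, c * (1 - Q (Sum.inr j)) := by
        rw [← Finset.mul_sum, Finset.sum_sub_distrib]; simp
      rw [this, ← Finset.sum_sub_distrib]
      exact Finset.sum_le_sum fun i _ => by nlinarith [hc i, hQ1 (Sum.inr i)]
    have e3 : ∑ i, a i * (r i - Q i) = Rf a X - ∑ i, a i * Q i := by
      simp only [mul_sub, Finset.sum_sub_distrib, hRf]
    rw [Fintype.sum_sum_type] at hcard
    rw [e3, Fintype.sum_sum_type (fun i => a i * Q i)]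
    nlinarith
  have n1 : 0 ≤ ∑ i, a i * (r i - Q i) :=
    Finset.sum_nonneg fun i _ => mul_nonneg (ha i).le (sub_nonneg.2 (hQr i))
  have n2 : 0 ≤ ∑ i, Q (Sum.inl i) := Finset.sum_nonneg fun i _ => hQ0 _
  refine ⟨by nlinarith, fun hle i k => ?_⟩
  have z1 : ∑ i, a i * (r i - Q i) = 0 := by nlinarith
  have z2 : ∑ i, Q (Sum.inl i) = 0 := by nlinarith
  have z3 := (Finset.sum_eq_zero_iff_of_nonneg (fun i _ => mul_nonneg (ha i).le (sub_nonneg.2 (hQr i)))).1 z1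
    (Sum.inl i) (Finset.mem_univ _)
  have z4 := (Finset.sum_eq_zero_iff_of_nonneg (fun i _ => hQ0 (Sum.inl i))).1 z2 i (Finset.mem_univ _)
  have z5 : r (Sum.inl i) = 0 := by
    rcases mul_eq_zero.1 z3 with h | h
    · exact absurd h (ha _).ne'
    · linarith
  have z6 := (Finset.sum_eq_zero_iff_of_nonneg (fun j _ => by positivity)).1 z5 k (Finset.mem_univ _)
  simpa using z6

theorem Rf_min {p q : Type*} [Fintype p] [Fintype q] [DecidableEq p] [DecidableEq q]
    (a : p ⊕ q → ℝ) (U : Matrix p p ℂ) (hU : U * Uᴴ = 1) :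
    Rf a (Matrix.fromRows U (0 : Matrix q p ℂ)) = ∑ j, a (Sum.inr j) := by
  have : (1 : Matrix (p ⊕ q) (p ⊕ q) ℂ) - Matrix.fromRows U (0 : Matrix q p ℂ) * (Matrix.fromRows U (0 : Matrix q p ℂ))ᴴ
      = Matrix.fromBlocks 0 0 0 1 := by
    rw [Matrix.conjTranspose_fromRows_eq_fromCols_conjTranspose, Matrix.fromRows_mul_fromCols, hU,
      ← Matrix.fromBlocks_one, sub_eq_add_neg, Matrix.fromBlocks_neg, Matrix.fromBlocks_add]
    simp [sub_eq_add_neg]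
  rw [Rf, this]
  simp [Fintype.sum_sum_type, Matrix.one_apply, apply_ite]

theorem row_bound {p q : Type*} [Fintype p] [Fintype q] [DecidableEq p] (B U : Matrix p p ℂ)
    (hU : Uᴴ * U = 1) (δ : ℝ) (hδ : ‖B - U‖ ≤ δ) (hδ1 : δ ≤ 1) (r : Matrix q p ℂ) :
    (1 - 2 * δ) * ‖r‖ ^ 2 ≤ ‖r * Bᴴ‖ ^ 2 := by
  have h1 : ‖r * Uᴴ‖ = ‖r‖ := by
    have : ‖r * Uᴴ‖ ^ 2 = ‖r‖ ^ 2 := by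
      rw [nsq_tr, nsq_tr, Matrix.trace_mul_comm, Matrix.trace_mul_comm rᴴ, Matrix.conjTranspose_mul,
        Matrix.conjTranspose_conjTranspose,
        show r * Uᴴ * (U * rᴴ) = r * (Uᴴ * U) * rᴴ by simp only [Matrix.mul_assoc], hU, Matrix.mul_one]
    exact (sq_eq_sq₀ (norm_nonneg _) (norm_nonneg _)).1 this
  have h2 : ‖r * (B - U)ᴴ‖ ≤ ‖r‖ * δ := by
    refine (Matrix.frobenius_norm_mul _ _).trans ?_
    rw [Matrix.frobenius_norm_conjTranspose]
    gcongr
  have h3 : ‖r * Uᴴ‖ ≤ ‖r * Bᴴ‖ + ‖r * (B - U)ᴴ‖ := by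
    have : r * Uᴴ = r * Bᴴ - r * (B - U)ᴴ := by
      rw [Matrix.conjTranspose_sub, Matrix.mul_sub]; abel
    rw [this]; exact norm_sub_le _ _
  have h4 : (1 - δ) * ‖r‖ ≤ ‖r * Bᴴ‖ := by linarith
  have h5 : ((1 - δ) * ‖r‖) ^ 2 ≤ ‖r * Bᴴ‖ ^ 2 :=
    pow_le_pow_left₀ (mul_nonneg (by linarith) (norm_nonneg _)) h4 2
  nlinarith [mul_nonneg (sq_nonneg δ) (sq_nonneg ‖r‖)]

theorem growth {p q : Type*} [Fintype p] [Fintype q] [DecidableEq p] [DecidableEq q]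
    (a : p ⊕ q → ℝ) (b c : ℝ) (hcb : c < b) (ha : ∀ i, 0 < a i)
    (hb : ∀ i, b ≤ a (Sum.inl i)) (hc : ∀ j, a (Sum.inr j) ≤ c) (hc0 : 0 ≤ c)
    (α δ : ℝ) (hα0 : 0 < α) (hα : α < 1) (hδ0 : 0 ≤ δ) (hδ : δ ≤ 1 / 4)
    (hδ' : 2 * δ * (b + c) ≤ (1 - α) * (b - c))
    (B U : Matrix p p ℂ) (T : Matrix q p ℂ) (hU : Uᴴ * U = 1) (hBU : ‖B - U‖ ≤ δ) :
    ∃ W : Matrix p p ℂ, W * Wᴴ = 1 ∧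
      α * (b - c) * ‖Matrix.fromRows B T - Matrix.fromRows W 0‖ ^ 2
        ≤ Rf a (Matrix.fromRows B T) - ∑ j, a (Sum.inr j) := by
  have hBu : IsUnit B := by
    have : IsUnit Bᴴ := by
      rw [← Matrix.vecMul_injective_iff_isUnit]
      intro v w hvw
      have := row_bound (q := Unit) B U hU δ hBU (by linarith) (Matrix.replicateRow Unit (v - w))
      have h0 : Matrix.replicateRow Unit (v - w) * Bᴴ = 0 := by
        rw [← Matrix.replicateRow_vecMul, Matrix.sub_vecMul, show v ᵥ* Bᴴ = w ᵥ* Bᴴ from hvw]; simp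
      rw [h0, norm_zero] at this
      have h1 : ‖Matrix.replicateRow Unit (v - w)‖ ^ 2 ≤ 0 := by
        nlinarith [sq_nonneg ‖Matrix.replicateRow Unit (v - w)‖]
      have h2 : Matrix.replicateRow Unit (v - w) = 0 := by
        rw [← norm_eq_zero]; nlinarith [sq_nonneg ‖Matrix.replicateRow Unit (v - w)‖]
      funext i
      have := congrFun (congrFun h2 ()) i
      simpa [sub_eq_zero] using this
    simpa using this.star
  obtain ⟨W, hW, -, hBW⟩ := polar B hBu
  refine ⟨W, hW, ?_⟩
  have hd : ‖Matrix.fromRows B T - Matrix.fromRows W 0‖ ^ 2 = ‖B - W‖ ^ 2 + ‖T‖ ^ 2 := by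
    rw [nsq, nsq, nsq, Fintype.sum_sum_type]; simp
  have hd2 : ‖B - W‖ ^ 2 ≤ ‖B * Bᴴ - 1‖ ^ 2 := pow_le_pow_left₀ (norm_nonneg _) hBW 2
  have hG : (1 : Matrix (p ⊕ q) (p ⊕ q) ℂ) - Matrix.fromRows B T * (Matrix.fromRows B T)ᴴ
      = Matrix.fromBlocks (1 - B * Bᴴ) (-(B * Tᴴ)) (-(T * Bᴴ)) (1 - T * Tᴴ) := by
    rw [Matrix.conjTranspose_fromRows_eq_fromCols_conjTranspose, Matrix.fromRows_mul_fromCols,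
      ← Matrix.fromBlocks_one, sub_eq_add_neg, Matrix.fromBlocks_neg, Matrix.fromBlocks_add]
    simp [sub_eq_add_neg]
  have hR : Rf a (Matrix.fromRows B T) =
      ∑ i, a (Sum.inl i) * (∑ j, ‖(B * Bᴴ - 1) i j‖ ^ 2 + ∑ j, ‖(B * Tᴴ) i j‖ ^ 2) +
      ∑ i, a (Sum.inr i) * (∑ j, ‖(T * Bᴴ) i j‖ ^ 2 + ∑ j, ‖(1 - T * Tᴴ : Matrix _ _ ℂ) i j‖ ^ 2) := by
    rw [Rf, hG, Fintype.sum_sum_type]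
    simp only [Fintype.sum_sum_type, Matrix.fromBlocks_apply₁₁, Matrix.fromBlocks_apply₁₂,
      Matrix.fromBlocks_apply₂₁, Matrix.fromBlocks_apply₂₂, Matrix.neg_apply, norm_neg]
    simp only [Matrix.sub_apply, norm_sub_rev]
  have b1 : b * (‖B * Bᴴ - 1‖ ^ 2 + ‖T * Bᴴ‖ ^ 2) ≤
      ∑ i, a (Sum.inl i) * (∑ j, ‖(B * Bᴴ - 1) i j‖ ^ 2 + ∑ j, ‖(B * Tᴴ) i j‖ ^ 2) := by
    rw [show ‖T * Bᴴ‖ = ‖B * Tᴴ‖ by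
      rw [← Matrix.frobenius_norm_conjTranspose, Matrix.conjTranspose_mul, Matrix.conjTranspose_conjTranspose],
      nsq, nsq, ← Finset.sum_add_distrib, Finset.mul_sum]
    exact Finset.sum_le_sum fun i _ => mul_le_mul_of_nonneg_right (hb i) (by positivity)
  have b2 : ∑ j, a (Sum.inr j) - c * (1 + 2 * δ) * ‖T‖ ^ 2 ≤
      ∑ i, a (Sum.inr i) * (∑ j, ‖(T * Bᴴ) i j‖ ^ 2 + ∑ j, ‖(1 - T * Tᴴ : Matrix _ _ ℂ) i j‖ ^ 2) := by
    rw [nsq, Finset.mul_sum, ← Finset.sum_sub_distrib]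
    refine Finset.sum_le_sum fun i _ => ?_
    have t1 := row_bound B U hU δ hBU (by linarith) (Matrix.replicateRow Unit (T i))
    rw [nsq, nsq] at t1
    simp only [Finset.univ_unique, Finset.sum_singleton, Matrix.replicateRow_apply] at t1
    have t2 : ∀ j, (Matrix.replicateRow Unit (T i) * Bᴴ) default j = (T * Bᴴ) i j := by
      intro j; simp [Matrix.mul_apply]
    simp only [t2] at t1
    set t := ∑ j, ‖T i j‖ ^ 2 with ht
    have ht0 : 0 ≤ t := by positivity
    have t3 : 1 - 2 * t ≤ ∑ j, ‖(1 - T * Tᴴ : Matrix _ _ ℂ) i j‖ ^ 2 := by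
      have h1 : ‖(1 - T * Tᴴ : Matrix _ _ ℂ) i i‖ ^ 2 ≤ ∑ j, ‖(1 - T * Tᴴ : Matrix _ _ ℂ) i j‖ ^ 2 :=
        Finset.single_le_sum (f := fun j => ‖(1 - T * Tᴴ : Matrix _ _ ℂ) i j‖ ^ 2) (fun j _ => by positivity)
          (Finset.mem_univ i)
      have h2 : (1 - T * Tᴴ : Matrix _ _ ℂ) i i = ((1 - t : ℝ) : ℂ) := by
        simp [Matrix.mul_apply, Complex.mul_conj, Complex.normSq_eq_norm_sq, ht]
      rw [h2, Complex.norm_real, Real.norm_eq_abs, sq_abs] at h1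
      nlinarith
    have hai := ha (Sum.inr i)
    have t4 : 1 - (1 + 2 * δ) * t ≤ ∑ j, ‖(T * Bᴴ) i j‖ ^ 2 + ∑ j, ‖(1 - T * Tᴴ : Matrix _ _ ℂ) i j‖ ^ 2 := by
      linarith
    have t5 := mul_le_mul_of_nonneg_left t4 hai.le
    have t6 : a (Sum.inr i) * ((1 + 2 * δ) * t) ≤ c * ((1 + 2 * δ) * t) :=
      mul_le_mul_of_nonneg_right (hc i) (by positivity)
    linarith
  have b3 := row_bound B U hU δ hBU (by linarith) T
  have b4 := mul_le_mul_of_nonneg_left b3 (by linarith : 0 ≤ b)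
  rw [hd, hR]
  have hα1 : α * (b - c) * ‖B - W‖ ^ 2 ≤ b * ‖B * Bᴴ - 1‖ ^ 2 := by
    apply mul_le_mul _ hd2 (by positivity) (by linarith)
    nlinarith
  have hα2 : 2 * δ * (b + c) * ‖T‖ ^ 2 ≤ (1 - α) * (b - c) * ‖T‖ ^ 2 :=
    mul_le_mul_of_nonneg_right hδ' (by positivity)
  linarith

theorem diagonalize {N : ℕ} {ι : Type*} [Fintype ι] [DecidableEq ι] (e : ι ≃ Fin N)
    (H : Matrix (Fin N) (Fin N) ℂ) (hH : H.IsHermitian)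
    (lam : Fin N → ℝ) (hmono : Monotone lam)
    (hchar : H.charpoly = ∏ i : Fin N, (Polynomial.X - Polynomial.C (lam i : ℂ))) :
    ∃ Φ : Matrix (Fin N) ι ℂ, Φ * Φᴴ = 1 ∧ Φᴴ * Φ = 1 ∧
      H = Φ * Matrix.diagonal (fun i => (lam (e i) : ℂ)) * Φᴴ := by
  have hroots : Multiset.map (fun i => (lam i : ℂ)) Finset.univ.val
      = Multiset.map (fun i => (hH.eigenvalues i : ℂ)) Finset.univ.val := by
    have h1 := hH.roots_charpoly_eq_eigenvalues
    rw [hchar, Polynomial.roots_prod _ _ (by simp [Finset.prod_ne_zero_iff, Polynomial.X_sub_C_ne_zero])] at h1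
    simpa [Function.comp_def] using h1
  have hperm : (List.ofFn lam).Perm (List.ofFn hH.eigenvalues) := by
    have h2 := congrArg (Multiset.map Complex.re) hroots
    rw [Multiset.map_map, Multiset.map_map] at h2
    simp only [Function.comp_def, Complex.ofReal_re, Fin.univ_val_map] at h2
    exact Multiset.coe_eq_coe.1 h2
  set σ := Tuple.sort hH.eigenvalues with hσ
  have hlam : lam = hH.eigenvalues ∘ σ := by
    apply List.ofFn_injective
    exact List.Perm.eq_of_sortedLE hmono.sortedLE_ofFn (Tuple.monotone_sort hH.eigenvalues).sortedLE_ofFn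
      (hperm.trans (Equiv.Perm.ofFn_comp_perm σ hH.eigenvalues).symm)
  set V : Matrix (Fin N) (Fin N) ℂ := (hH.eigenvectorUnitary : Matrix (Fin N) (Fin N) ℂ) with hV
  have hV1 : V * Vᴴ = 1 := Unitary.mul_star_self_of_mem hH.eigenvectorUnitary.2
  have hV2 : Vᴴ * V = 1 := Unitary.star_mul_self_of_mem hH.eigenvectorUnitary.2
  have hsp : H = V * Matrix.diagonal (fun i => (hH.eigenvalues i : ℂ)) * Vᴴ := by
    conv_lhs => rw [hH.spectral_theorem, Unitary.conjStarAlgAut_apply]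
    rfl
  set f : ι ≃ Fin N := e.trans σ with hf
  refine ⟨V.submatrix id f, ?_, ?_, ?_⟩
  · rw [Matrix.conjTranspose_submatrix, Matrix.submatrix_mul_equiv, hV1]; simp
  · rw [Matrix.conjTranspose_submatrix, ← Matrix.submatrix_mul _ _ _ _ _ Function.bijective_id, hV2]
    simp
  · have : Matrix.diagonal (fun i => (lam (e i) : ℂ))
        = (Matrix.diagonal (fun i => (hH.eigenvalues i : ℂ))).submatrix f f := by
      rw [Matrix.submatrix_diagonal_equiv, hlam]; rfl
    rw [this, Matrix.conjTranspose_submatrix, Matrix.submatrix_mul_equiv, Matrix.submatrix_mul_equiv, ← hsp]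
    simp

theorem E0_eq_s12 {N m : ℕ} {ι : Type*} [Fintype ι] [DecidableEq ι] (a : ι → ℝ)
    (H : Matrix (Fin N) (Fin N) ℂ) (Φ : Matrix (Fin N) ι ℂ) (h1 : Φᴴ * Φ = 1)
    (hH : H = Φ * Matrix.diagonal (fun i => ((-a i : ℝ) : ℂ)) * Φᴴ) (Z : Matrix ι (Fin m) ℂ) :
    E0 H (Φ * Z) = Rf a Z - ∑ i, a i := by
  set D : Matrix ι ι ℂ := Matrix.diagonal (fun i => ((-a i : ℝ) : ℂ)) with hD
  have e1 : (Φ * Z)ᴴ * (Φ * Z) = Zᴴ * Z := by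
    rw [Matrix.conjTranspose_mul, show Zᴴ * Φᴴ * (Φ * Z) = Zᴴ * (Φᴴ * Φ) * Z by
      simp only [Matrix.mul_assoc], h1, Matrix.mul_one]
  have e2 : (Φ * Z)ᴴ * H * (Φ * Z) = Zᴴ * (D * Z) := by
    rw [Matrix.conjTranspose_mul, hH, show Zᴴ * Φᴴ * (Φ * D * Φᴴ) * (Φ * Z)
      = Zᴴ * (Φᴴ * Φ) * D * (Φᴴ * Φ) * Z by simp only [Matrix.mul_assoc], h1]
    simp only [Matrix.mul_one, Matrix.mul_assoc]
  set M : Matrix ι ι ℂ := 1 - Z * Zᴴ with hM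
  have hMh : Mᴴ = M := by simp [hM]
  have e3 : (((2 : ℂ) • (1 : Matrix (Fin m) (Fin m) ℂ) - Zᴴ * Z) * (Zᴴ * (D * Z))).trace
      = D.trace - (D * (M * Mᴴ)).trace := by
    have e4 : D * (M * Mᴴ) = D - (2 : ℂ) • (D * (Z * Zᴴ)) + D * (Z * Zᴴ * (Z * Zᴴ)) := by
      rw [hMh, hM, show (2 : ℂ) • (D * (Z * Zᴴ)) = D * (Z * Zᴴ) + D * (Z * Zᴴ) from two_smul _ _]
      noncomm_ring
    rw [e4, Matrix.trace_add, Matrix.trace_sub, Matrix.sub_mul, Matrix.trace_sub, Matrix.smul_mul,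
      Matrix.trace_smul, Matrix.trace_smul, Matrix.one_mul]
    have t1 : (Zᴴ * (D * Z)).trace = (D * (Z * Zᴴ)).trace := by
      rw [Matrix.trace_mul_comm, Matrix.mul_assoc]
    have t2 : (Zᴴ * Z * (Zᴴ * (D * Z))).trace = (D * (Z * Zᴴ * (Z * Zᴴ))).trace := by
      rw [show Zᴴ * Z * (Zᴴ * (D * Z)) = (Zᴴ * Z * Zᴴ) * (D * Z) by simp only [Matrix.mul_assoc],
        Matrix.trace_mul_comm]
      simp only [Matrix.mul_assoc]
    rw [t1, t2]; ring
  rw [E0, e1, e2, e3, Rf, ← hM]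
  have e5 : (D * (M * Mᴴ)).trace = ((-∑ i, a i * ∑ j, ‖M i j‖ ^ 2 : ℝ) : ℂ) := by
    rw [Matrix.trace, ← Finset.sum_neg_distrib]
    push_cast
    refine Finset.sum_congr rfl fun i _ => ?_
    rw [Matrix.diag_apply, hD, Matrix.diagonal_mul, Matrix.mul_apply]
    simp [Complex.mul_conj, Complex.normSq_eq_norm_sq]
  have e6 : D.trace = ((-∑ i, a i : ℝ) : ℂ) := by
    simp [hD, Matrix.trace_diagonal]
  rw [e5, e6, ← Complex.ofReal_sub, Complex.ofReal_re]
  ring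

theorem norm_unitary_mul {N m : ℕ} {ι : Type*} [Fintype ι] [DecidableEq ι]
    (Φ : Matrix (Fin N) ι ℂ) (h1 : Φᴴ * Φ = 1) (Z : Matrix ι (Fin m) ℂ) : ‖Φ * Z‖ = ‖Z‖ := by
  refine (sq_eq_sq₀ (norm_nonneg _) (norm_nonneg _)).1 ?_
  rw [nsq_tr, nsq_tr, Matrix.conjTranspose_mul, show Zᴴ * Φᴴ * (Φ * Z) = Zᴴ * (Φᴴ * Φ) * Z by
      simp only [Matrix.mul_assoc], h1, Matrix.mul_one]

/-- Quadratic growth of `E₀` near its minimizing set: if `λ_m < λ_{m+1}` and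
`α ∈ (0,1)`, then for `X` close enough to `S₀`,
`E₀(X) − min E₀ ≥ α(λ_{m+1} − λ_m) d(X, S₀)²`. -/
theorem stmt12 {N m : ℕ} (hm : 0 < m) (hmN : m < N)
    (H : Matrix (Fin N) (Fin N) ℂ) (hH : H.IsHermitian) (hneg : (-H).PosDef)
    (lam : Fin N → ℝ) (hmono : Monotone lam)
    (hchar : H.charpoly = ∏ i : Fin N, (Polynomial.X - Polynomial.C (lam i : ℂ)))
    (hgap : lam ⟨m - 1, by omega⟩ < lam ⟨m, hmN⟩)
    (α : ℝ) (hα : α ∈ Set.Ioo (0 : ℝ) 1) :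
    ∃ δ > (0 : ℝ), ∀ X : Matrix (Fin N) (Fin m) ℂ,
      Metric.infDist X {Y : Matrix (Fin N) (Fin m) ℂ | ∀ Z : Matrix (Fin N) (Fin m) ℂ, E0 H Y ≤ E0 H Z} < δ →
      ∀ X₀ ∈ {Y : Matrix (Fin N) (Fin m) ℂ | ∀ Z : Matrix (Fin N) (Fin m) ℂ, E0 H Y ≤ E0 H Z},
        α * (lam ⟨m, hmN⟩ - lam ⟨m - 1, by omega⟩) *
            (Metric.infDist X {Y : Matrix (Fin N) (Fin m) ℂ | ∀ Z : Matrix (Fin N) (Fin m) ℂ, E0 H Y ≤ E0 H Z}) ^ 2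
          ≤ E0 H X - E0 H X₀ := by
  obtain ⟨n, rfl⟩ : ∃ n, N = m + n := ⟨N - m, by omega⟩
  obtain ⟨Φ, hΦ1, hΦ2, hHΦ⟩ := diagonalize (finSumFinEquiv (m := m) (n := n)) H hH lam hmono hchar
  set S : Set (Matrix (Fin (m + n)) (Fin m) ℂ) :=
    {Y : Matrix (Fin (m + n)) (Fin m) ℂ | ∀ Z : Matrix (Fin (m + n)) (Fin m) ℂ, E0 H Y ≤ E0 H Z} with hS
  set b : ℝ := -lam ⟨m - 1, by omega⟩ with hb
  set c : ℝ := -lam ⟨m, hmN⟩ with hc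
  set a : Fin m ⊕ Fin n → ℝ := fun i => -lam (finSumFinEquiv i) with ha
  have ha0 : ∀ i, 0 < a i := by
    intro i
    have hinj : Function.Injective Φ.mulVec := by
      intro v w hvw
      have := congrArg (Φᴴ *ᵥ ·) hvw
      simpa [Matrix.mulVec_mulVec, hΦ2] using this
    have h1 := (hneg.conjTranspose_mul_mul_same hinj).diag_pos (i := i)
    have h2 : Φᴴ * -H * Φ = Matrix.diagonal (fun i => ((a i : ℝ) : ℂ)) := by
      rw [Matrix.mul_neg, Matrix.neg_mul, hHΦ]
      rw [show Φᴴ * (Φ * Matrix.diagonal (fun i => (lam (finSumFinEquiv i) : ℂ)) * Φᴴ) * Φ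
        = (Φᴴ * Φ) * Matrix.diagonal (fun i => (lam (finSumFinEquiv i) : ℂ)) * (Φᴴ * Φ) by
          simp only [Matrix.mul_assoc], hΦ2, Matrix.one_mul, Matrix.mul_one, Matrix.diagonal_neg]
      congr 1; funext i; simp [ha]
    rw [h2, Matrix.diagonal_apply_eq] at h1
    exact_mod_cast h1
  have hHa : H = Φ * Matrix.diagonal (fun i => ((-a i : ℝ) : ℂ)) * Φᴴ := by
    simpa [ha] using hHΦ
  have hba : ∀ i, b ≤ a (Sum.inl i) := by
    intro i
    simp only [hb, ha, neg_le_neg_iff]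
    apply hmono
    rw [Fin.le_def]; simp; omega
  have hca : ∀ j, a (Sum.inr j) ≤ c := by
    intro i
    simp only [hc, ha, neg_le_neg_iff]
    apply hmono
    rw [Fin.le_def]; simp
  have hcb : c < b := by simp only [hb, hc]; linarith
  have hc0 : 0 ≤ c := (ha0 (Sum.inr ⟨0, by omega⟩)).le.trans (hca _)
  have hE : ∀ Z : Matrix (Fin m ⊕ Fin n) (Fin m) ℂ, E0 H (Φ * Z) = Rf a Z - ∑ i, a i :=
    fun Z => E0_eq_s12 a H Φ hΦ2 hHa Z
  have hX : ∀ X : Matrix (Fin (m + n)) (Fin m) ℂ, Φ * (Φᴴ * X) = X := by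
    intro X; rw [← Matrix.mul_assoc, hΦ1, Matrix.one_mul]
  have hmem : ∀ W : Matrix (Fin m) (Fin m) ℂ, W * Wᴴ = 1 → Φ * Matrix.fromRows W (0 : Matrix (Fin n) (Fin m) ℂ) ∈ S := by
    intro W hW Z
    rw [hE, Rf_min a W hW, ← hX Z, hE]
    have := (kyfan a b c hcb ha0 hba hca hc0 (Φᴴ * Z)).1
    linarith
  have hmin : ∀ Y ∈ S, E0 H Y = ∑ j, a (Sum.inr j) - ∑ i, a i := by
    intro Y hY
    refine le_antisymm ?_ ?_
    · have := hY (Φ * Matrix.fromRows (1 : Matrix (Fin m) (Fin m) ℂ) (0 : Matrix (Fin n) (Fin m) ℂ))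
      rwa [hE, Rf_min a 1 (by simp)] at this
    · rw [← hX Y, hE]
      have := (kyfan a b c hcb ha0 hba hca hc0 (Φᴴ * Y)).1
      linarith
  obtain ⟨hα0, hα1⟩ := hα
  set δ : ℝ := min (1 / 4) ((1 - α) * (b - c) / (2 * (b + c))) with hδ
  have hbc : 0 < b + c := by linarith
  have hδ0 : 0 < δ := by
    apply lt_min (by norm_num)
    apply div_pos (mul_pos (by linarith) (by linarith)) (by linarith)
  have hδ1 : δ ≤ 1 / 4 := min_le_left _ _
  have hδ2 : 2 * δ * (b + c) ≤ (1 - α) * (b - c) := by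
    have : δ ≤ (1 - α) * (b - c) / (2 * (b + c)) := min_le_right _ _
    rw [le_div_iff₀ (by linarith)] at this
    linarith
  refine ⟨δ, hδ0, fun X hXd X₀ hX₀ => ?_⟩
  obtain ⟨Y, hY, hXY⟩ := (Metric.infDist_lt_iff ⟨X₀, hX₀⟩).1 hXd
  set ZX := Φᴴ * X with hZX
  set ZY := Φᴴ * Y with hZY
  have hYrow := (kyfan a b c hcb ha0 hba hca hc0 ZY).2 (by
    have := hmin Y hY
    rw [← hX Y, hE] at this
    linarith)
  set U := ZY.toRows₁ with hU
  have hUU : U * Uᴴ = 1 := by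
    ext i k
    have := hYrow i (Sum.inl k)
    rw [Matrix.sub_apply, sub_eq_zero] at this
    have h2 : (U * Uᴴ) i k = (ZY * ZYᴴ) (Sum.inl i) (Sum.inl k) := by
      simp [Matrix.mul_apply, hU, Matrix.toRows₁]
    rw [h2, ← this]; simp [Matrix.one_apply]
  have hBU : ‖ZX.toRows₁ - U‖ ≤ δ := by
    have h1 : ‖ZX - ZY‖ = dist X Y := by
      rw [dist_eq_norm, ← norm_unitary_mul Φ hΦ2, Matrix.mul_sub, hZX, hZY, hX, hX]
    have h2 : ‖ZX.toRows₁ - U‖ ≤ ‖ZX - ZY‖ := by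
      refine (sq_le_sq₀ (norm_nonneg _) (norm_nonneg _)).1 ?_
      rw [nsq, nsq, Fintype.sum_sum_type]
      simp only [hU, Matrix.sub_apply, Matrix.toRows₁_apply]
      exact le_add_of_nonneg_right (by positivity)
    linarith
  obtain ⟨W, hW, hgr⟩ := growth a b c hcb ha0 hba hca hc0 α δ hα0 hα1 hδ0.le hδ1 hδ2
    ZX.toRows₁ U ZX.toRows₂ (mul_eq_one_comm.1 hUU) hBU
  rw [Matrix.fromRows_toRows] at hgr
  have hdist : Metric.infDist X S ≤ ‖ZX - Matrix.fromRows W 0‖ := by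
    refine (Metric.infDist_le_dist_of_mem (hmem W hW)).trans (le_of_eq ?_)
    rw [dist_eq_norm, ← norm_unitary_mul Φ hΦ2 (ZX - _), Matrix.mul_sub, hZX, hX]
  have hsq := pow_le_pow_left₀ Metric.infDist_nonneg hdist 2
  have hEX : E0 H X = Rf a ZX - ∑ i, a i := by rw [← hE, hZX, hX]
  rw [hmin X₀ hX₀, hEX]
  have hgc : lam ⟨m, hmN⟩ - lam ⟨m - 1, by omega⟩ = b - c := by simp only [hb, hc]; ring
  rw [hgc]
  have := mul_le_mul_of_nonneg_left hsq (mul_pos hα0 (sub_pos.2 hcb)).le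
  linarith
end
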